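/- The factor complexity of every morphic sequence either equals Θ(n^{1+1/k}) for some positive integer k, or is O(n log n). -/

import Mathlib

open Filter Asymptotics

variable {A : Type*}

/-- Extension of a morphism, given on letters, to words. -/
def wordMap (φ : A → List A) (w : List A) : List A := w.flatMap φ

/-- The factor of the infinite word α of length n starting at position i. -/
def factorAt (α : ℕ → A) (i n : ℕ) : List A := (List.range n).map (fun j => α (i + j))

/-- w is a factor (contiguous subword) of the infinite word α. -/
def IsFactor (α : ℕ → A) (w : List A) : Prop := ∃ i, w = factorAt α i w.length

/-- The factor complexity of α: the number of distinct factors of length n. -/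
noncomputable def complexity (α : ℕ → A) (n : ℕ) : ℕ :=
  Set.ncard {w : List A | w.length = n ∧ IsFactor α w}

def UltimatelyPeriodic (α : ℕ → A) : Prop :=
  ∃ N p : ℕ, 1 ≤ p ∧ ∀ i, N ≤ i → α (i + p) = α i

/-- φ is prolongable on a: φ(a) = a·w with w nonempty and |φ^n(a)| → ∞. -/
def Prolongable (φ : A → List A) (a : A) : Prop :=
  (∃ w, w ≠ [] ∧ φ a = a :: w) ∧
    Tendsto (fun n => ((wordMap φ)^[n] [a]).length) atTop atTop

/-- α is the pure morphic sequence φ^∞(a): every iterate φ^n(a) is a prefix of α. -/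
def IsFixedSeq (φ : A → List A) (a : A) (α : ℕ → A) : Prop :=
  ∀ n, factorAt α 0 ((wordMap φ)^[n] [a]).length = (wordMap φ)^[n] [a]

/-- The letter b is growing for φ: |φ^k(b)| → ∞. -/
def GrowingLetter (φ : A → List A) (b : A) : Prop :=
  Tendsto (fun k => ((wordMap φ)^[k] [b]).length) atTop atTop

def BoundedLetter (φ : A → List A) (b : A) : Prop := ¬ GrowingLetter φ b

/-- φ is growing: every letter is growing. -/
def Growing (φ : A → List A) : Prop := ∀ b, GrowingLetter φ b

section Periodicity

variable {B : Type*} {P : ℕ}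

theorem hasPeriod_iff_lt {w : List B} :
    w.HasPeriod P ↔ ∀ i, i + P < w.length → w[i]? = w[i + P]? := by
  rw [List.hasPeriod_iff_getElem?]
  exact ⟨fun h i hi => h i (by omega), fun h i hi => h i (by omega)⟩

theorem List.HasPeriod.glue {x m y : List B} (hm : P ≤ m.length) (h₁ : (x ++ m).HasPeriod P)
    (h₂ : (m ++ y).HasPeriod P) : (x ++ m ++ y).HasPeriod P := by
  rw [hasPeriod_iff_lt] at *
  intro i hi
  simp only [List.length_append] at hi h₁ h₂
  by_cases h : i + P < x.length + m.length
  · have := h₁ i h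
    rw [List.getElem?_append_left (l₁ := x ++ m) (by simp; omega),
      List.getElem?_append_left (l₁ := x ++ m) (by simp; omega)]
    exact this
  · have := h₂ (i - x.length) (by omega)
    rw [List.append_assoc, List.getElem?_append_right (l₁ := x) (by omega),
      List.getElem?_append_right (l₁ := x) (by omega), this]
    congr 1
    omega

theorem List.HasPeriod.reverse {w : List B} (h : w.HasPeriod P) : w.reverse.HasPeriod P := by
  rw [hasPeriod_iff_lt] at *
  intro i hi
  rw [List.length_reverse] at hi
  rw [List.getElem?_reverse (by omega), List.getElem?_reverse (by omega)]
  have := h (w.length - 1 - (i + P)) (by omega)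
  rw [this]
  congr 1
  omega

theorem hasPeriod_reverse {w : List B} : w.reverse.HasPeriod P ↔ w.HasPeriod P :=
  ⟨fun h => by simpa using h.reverse, fun h => h.reverse⟩

theorem List.HasPeriod.dvd {w : List B} {q : ℕ} (h : w.HasPeriod q) (hq : q ∣ P) :
    w.HasPeriod P := by
  rw [List.hasPeriod_iff_forall_getElem?_mod] at h
  rw [hasPeriod_iff_lt]
  intro i hi
  rw [h i (by omega), h (i + P) hi]
  obtain ⟨c, rfl⟩ := hq
  simp

/-- A word glued from a prefix, a long periodic word and a suffix. -/
theorem List.HasPeriod.append_of_suffix {z s u : List B} (hs : s <:+ z) (hl : s.length = P)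
    (hz : z.HasPeriod P) (h : (s ++ u).HasPeriod P) : (z ++ u).HasPeriod P := by
  obtain ⟨t, rfl⟩ := hs
  exact List.HasPeriod.glue hl.ge hz h

theorem List.HasPeriod.append_of_prefix {z p u : List B} (hp : p <+: z) (hl : p.length = P)
    (hz : z.HasPeriod P) (h : (u ++ p).HasPeriod P) : (u ++ z).HasPeriod P := by
  obtain ⟨t, rfl⟩ := hp
  rw [← List.append_assoc]
  exact List.HasPeriod.glue hl.ge h hz

end Periodicity

section EventuallyPolynomial

/-- `f` agrees eventually with a polynomial of degree at most `d`. -/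
def EvPoly : ℕ → (ℕ → ℤ) → Prop
  | 0, f => ∃ c, ∀ᶠ N in atTop, f N = c
  | d + 1, f => EvPoly d (fun N => f (N + 1) - f N)

theorem EvPoly.congr {d : ℕ} {f g : ℕ → ℤ} (hf : EvPoly d f) (h : ∀ᶠ N in atTop, f N = g N) :
    EvPoly d g := by
  induction d generalizing f g with
  | zero =>
    obtain ⟨c, hc⟩ := hf
    exact ⟨c, by filter_upwards [hc, h] with N h1 h2; rw [← h2, h1]⟩
  | succ d ih =>
    refine ih (f := fun N => f (N + 1) - f N) hf ?_
    filter_upwards [h, (tendsto_add_atTop_nat 1).eventually h] with N h1 h2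
    rw [h1, h2]

theorem EvPoly.const (d : ℕ) (c : ℤ) : EvPoly d (fun _ => c) := by
  induction d generalizing c with
  | zero => exact ⟨c, by simp⟩
  | succ d ih =>
    change EvPoly d (fun _ => c - c)
    exact ih _

theorem EvPoly.add {d : ℕ} {f g : ℕ → ℤ} (hf : EvPoly d f) (hg : EvPoly d g) :
    EvPoly d (fun N => f N + g N) := by
  induction d generalizing f g with
  | zero =>
    obtain ⟨c, hc⟩ := hf
    obtain ⟨c', hc'⟩ := hg
    exact ⟨c + c', by filter_upwards [hc, hc'] with N h1 h2; rw [h1, h2]⟩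
  | succ d ih =>
    change EvPoly d (fun N => f (N + 1) + g (N + 1) - (f N + g N))
    refine EvPoly.congr
      (ih (f := fun N => f (N + 1) - f N) (g := fun N => g (N + 1) - g N) hf hg) ?_
    exact Eventually.of_forall fun N => by ring

theorem EvPoly.of_succ {d : ℕ} {f : ℕ → ℤ} (hf : EvPoly d (fun N => f (N + 1))) : EvPoly d f := by
  induction d generalizing f with
  | zero =>
    obtain ⟨c, hc⟩ := hf
    refine ⟨c, ?_⟩
    rw [eventually_atTop] at *
    obtain ⟨a, ha⟩ := hc
    refine ⟨a + 1, fun b hb => ?_⟩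
    have : f (b - 1 + 1) = c := ha (b - 1) (by omega)
    rwa [Nat.sub_add_cancel (by omega)] at this
  | succ d ih => exact ih (f := fun N => f (N + 1) - f N) hf

theorem EvPoly.succ_arg {d : ℕ} {f : ℕ → ℤ} (hf : EvPoly d f) : EvPoly d (fun N => f (N + 1)) := by
  induction d generalizing f with
  | zero =>
    obtain ⟨c, hc⟩ := hf
    exact ⟨c, (tendsto_add_atTop_nat 1).eventually hc⟩
  | succ d ih => exact ih (f := fun N => f (N + 1) - f N) hf

theorem EvPoly.succ {d : ℕ} {f : ℕ → ℤ} (hf : EvPoly d f) : EvPoly (d + 1) f := by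
  induction d generalizing f with
  | zero =>
    obtain ⟨c, hc⟩ := hf
    refine ⟨0, ?_⟩
    filter_upwards [hc, (tendsto_add_atTop_nat 1).eventually hc] with N h1 h2
    rw [h1, h2, sub_self]
  | succ d ih => exact ih (f := fun N => f (N + 1) - f N) hf

theorem EvPoly.mono {d e : ℕ} {f : ℕ → ℤ} (hf : EvPoly d f) (h : d ≤ e) : EvPoly e f := by
  induction h with
  | refl => exact hf
  | step _ ih => exact ih.succ

end EventuallyPolynomial

section Runs

variable {B : Type*} {P d : ℕ}

/-- A family of words of period `P` with constant first and last `P` letters `p` and `s`, whose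
lengths tend to infinity and agree eventually with a polynomial of degree at most `d`. -/
structure IsRun (P d : ℕ) (z : ℕ → List B) (p s : List B) : Prop where
  length_prefix : p.length = P
  length_suffix : s.length = P
  eventually_run : ∀ᶠ N in atTop, p <+: z N ∧ s <:+ z N ∧ (z N).HasPeriod P
  evPoly : EvPoly d (fun N => ((z N).length : ℤ))
  tendsto_length : Tendsto (fun N => (z N).length) atTop atTop

variable {z z' : ℕ → List B} {p s p' s' u : List B}

theorem IsRun.mono {e : ℕ} (h : IsRun P d z p s) (hde : d ≤ e) : IsRun P e z p s :=
  { h with evPoly := h.evPoly.mono hde }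

theorem IsRun.not_zero (h : IsRun P 0 z p s) : False := by
  obtain ⟨c, hc⟩ := h.evPoly
  obtain ⟨N, h1, h2⟩ := (hc.and (h.tendsto_length.eventually_gt_atTop c.toNat)).exists
  have h1 : ((z N).length : ℤ) = c := h1
  omega

theorem IsRun.reverse (h : IsRun P d z p s) :
    IsRun P d (fun N => (z N).reverse) s.reverse p.reverse where
  length_prefix := by simp [h.length_suffix]
  length_suffix := by simp [h.length_prefix]
  eventually_run := by
    filter_upwards [h.eventually_run] with N ⟨h1, h2, h3⟩
    exact ⟨by simpa using h2, by simpa using h1, h3.reverse⟩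
  evPoly := by simpa using h.evPoly
  tendsto_length := by simpa using h.tendsto_length

theorem IsRun.succ_arg (h : IsRun P d z p s) : IsRun P d (fun N => z (N + 1)) p s where
  length_prefix := h.length_prefix
  length_suffix := h.length_suffix
  eventually_run := (tendsto_add_atTop_nat 1).eventually h.eventually_run
  evPoly := h.evPoly.succ_arg (f := fun N => ((z N).length : ℤ))
  tendsto_length := h.tendsto_length.comp (tendsto_add_atTop_nat 1)

theorem IsRun.pred_arg (h : IsRun P d z p s) : IsRun P d (fun N => z (N - 1)) p s where
  length_prefix := h.length_prefix
  length_suffix := h.length_suffix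
  eventually_run := (tendsto_sub_atTop_nat 1).eventually h.eventually_run
  evPoly := EvPoly.of_succ (by simpa using h.evPoly)
  tendsto_length := h.tendsto_length.comp (tendsto_sub_atTop_nat 1)

theorem IsRun.append_const (h : IsRun P d z p s) (hu : (s ++ u).HasPeriod P) :
    ∃ s', IsRun P d (fun N => z N ++ u) p s' := by
  refine ⟨(s ++ u).drop u.length, h.length_prefix, ?_, ?_, ?_, ?_⟩
  · simp [h.length_suffix]
  · filter_upwards [h.eventually_run] with N ⟨h1, h2, h3⟩
    refine ⟨h1.trans (List.prefix_append _ _), ?_, h3.append_of_suffix h2 h.length_suffix hu⟩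
    refine (List.drop_suffix _ _).trans ?_
    obtain ⟨t, ht⟩ := h2
    exact ⟨t, by rw [← ht]; simp⟩
  · simpa using h.evPoly.add (EvPoly.const d u.length)
  · exact tendsto_atTop_mono (fun N => by simp) h.tendsto_length

theorem IsRun.const_append (h : IsRun P d z p s) (hu : (u ++ p).HasPeriod P) :
    ∃ p', IsRun P d (fun N => u ++ z N) p' s := by
  obtain ⟨s', hs'⟩ := h.reverse.append_const (u := u.reverse) (by simpa using hu.reverse)
  exact ⟨s'.reverse, by simpa using hs'.reverse⟩

theorem IsRun.append_run (h : IsRun P d z p s) (h' : IsRun P d z' p' s')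
    (hu : (s ++ u ++ p').HasPeriod P) : IsRun P d (fun N => z N ++ u ++ z' N) p s' where
  length_prefix := h.length_prefix
  length_suffix := h'.length_suffix
  eventually_run := by
    filter_upwards [h.eventually_run, h'.eventually_run] with N ⟨h1, h2, h3⟩ ⟨h1', h2', h3'⟩
    refine ⟨?_, ?_, ?_⟩
    · rw [List.append_assoc]; exact h1.trans (List.prefix_append _ _)
    · exact h2'.trans (List.suffix_append _ _)
    · refine h3'.append_of_prefix h1' h'.length_prefix ?_
      rw [List.append_assoc] at hu ⊢
      exact h3.append_of_suffix h2 h.length_suffix hu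
  evPoly := by
    simpa [add_assoc] using (h.evPoly.add (EvPoly.const d u.length)).add h'.evPoly
  tendsto_length := by
    refine tendsto_atTop_mono (fun N => ?_) h.tendsto_length
    simp only [List.length_append]; omega

/-- A run or an empty family of words. -/
def OptRun (P d : ℕ) (z : ℕ → List B) (p s : List B) : Prop :=
  IsRun P d z p s ∨ ((∀ N, z N = []) ∧ p = [] ∧ s = [])

theorem OptRun.mono {e : ℕ} (h : OptRun P d z p s) (hde : d ≤ e) : OptRun P e z p s :=
  h.imp_left (·.mono hde)

theorem OptRun.reverse (h : OptRun P d z p s) :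
    OptRun P d (fun N => (z N).reverse) s.reverse p.reverse :=
  h.imp (·.reverse) (by rintro ⟨h1, rfl, rfl⟩; simpa using h1)

theorem OptRun.pred_arg (h : OptRun P d z p s) : OptRun P d (fun N => z (N - 1)) p s :=
  h.imp (·.pred_arg) (by rintro ⟨h1, rfl, rfl⟩; simpa using fun N => h1 (N - 1))

theorem OptRun.prefix_suffix (h : OptRun P d z p s) :
    ∀ᶠ N in atTop, p <+: z N ∧ s <:+ z N := by
  rcases h with h | ⟨_, rfl, rfl⟩
  · filter_upwards [h.eventually_run] with N h using ⟨h.1, h.2.1⟩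
  · simp

theorem OptRun.evPoly (h : OptRun P d z p s) : EvPoly d (fun N => ((z N).length : ℤ)) := by
  rcases h with h | ⟨h, rfl, rfl⟩
  · exact h.evPoly
  · simpa [h] using EvPoly.const d 0

theorem OptRun.append_run (h : OptRun P d z p s) (h' : IsRun P d z' p' s')
    (hu : (s ++ u ++ p').HasPeriod P) : ∃ q, IsRun P d (fun N => z N ++ u ++ z' N) q s' := by
  rcases h with h | ⟨h, rfl, rfl⟩
  · exact ⟨p, h.append_run h' hu⟩
  · simpa [h] using h'.const_append (by simpa using hu)

theorem IsRun.append_optRun (h : IsRun P d z p s) (h' : OptRun P d z' p' s')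
    (hu : (s ++ u ++ p').HasPeriod P) : ∃ q, IsRun P d (fun N => z N ++ u ++ z' N) p q := by
  rcases h' with h' | ⟨h', rfl, rfl⟩
  · exact ⟨s', h.append_run h' hu⟩
  · simpa [h'] using h.append_const (by simpa using hu)

/-- A family of words with at most one place where the period `P` is broken. -/
def Simple (P d : ℕ) (v : ℕ → List B) : Prop :=
  ∃ z z' p s p' s' u, OptRun P d z p s ∧ OptRun P d z' p' s' ∧
    ∀ᶠ N in atTop, v N = z N ++ u ++ z' N

variable {v v' : ℕ → List B}

theorem Simple.mono {e : ℕ} (h : Simple P d v) (hde : d ≤ e) : Simple P e v := by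
  obtain ⟨z, z', p, s, p', s', u, hz, hz', hv⟩ := h
  exact ⟨z, z', p, s, p', s', u, hz.mono hde, hz'.mono hde, hv⟩

theorem Simple.reverse (h : Simple P d v) : Simple P d (fun N => (v N).reverse) := by
  obtain ⟨z, z', p, s, p', s', u, hz, hz', hv⟩ := h
  refine ⟨_, _, _, _, _, _, u.reverse, hz'.reverse, hz.reverse, ?_⟩
  filter_upwards [hv] with N h
  simp [h]

theorem Simple.of_succ (h : Simple P d (fun N => v (N + 1))) : Simple P d v := by
  obtain ⟨z, z', p, s, p', s', u, hz, hz', hv⟩ := h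
  refine ⟨_, _, _, _, _, _, u, hz.pred_arg, hz'.pred_arg, ?_⟩
  filter_upwards [(tendsto_sub_atTop_nat 1).eventually hv, eventually_ge_atTop 1] with N h h1
  rwa [Nat.sub_add_cancel h1] at h

theorem Simple.of_add {m : ℕ} (h : Simple P d (fun N => v (N + m))) : Simple P d v := by
  induction m with
  | zero => exact h
  | succ m ih => exact ih (Simple.of_succ (by simpa [add_assoc, add_comm 1 m] using h))

theorem Simple.const (u : List B) (h : ∀ᶠ N in atTop, v N = u) : Simple P d v :=
  ⟨fun _ => [], fun _ => [], [], [], [], [], u, Or.inr (by simp), Or.inr (by simp), by simpa using h⟩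

theorem Simple.evPoly (h : Simple P d v) : EvPoly d (fun N => ((v N).length : ℤ)) := by
  obtain ⟨z, z', p, s, p', s', u, hz, hz', hv⟩ := h
  refine ((hz.evPoly.add (EvPoly.const d u.length)).add hz'.evPoly).congr ?_
  filter_upwards [hv] with N h
  simp [h, add_assoc]

/-- No run whose length is eventually a polynomial of degree at most `d` occurs in `L` between
two breaks of the period `P`. -/
def NoBrokenRun (P d : ℕ) (L : Set (List B)) : Prop :=
  ∀ (z : ℕ → List B) (p s l r : List B), IsRun P d z p s →
    (∀ᶠ N in atTop, l ++ z N ++ r ∈ L) → (l ++ p).HasPeriod P ∨ (s ++ r).HasPeriod P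

def FactorClosed (L : Set (List B)) : Prop := ∀ w ∈ L, ∀ w', w' <:+: w → w' ∈ L

variable {L : Set (List B)}

theorem NoBrokenRun.zero : NoBrokenRun P 0 L := fun _ _ _ _ _ h _ => h.not_zero.elim

theorem NoBrokenRun.mono {e : ℕ} (h : NoBrokenRun P d L) (hed : e ≤ d) : NoBrokenRun P e L :=
  fun z p s l r hz hl => h z p s l r (hz.mono hed) hl

theorem NoBrokenRun.reverse (h : NoBrokenRun P d L) : NoBrokenRun P d (List.reverse ⁻¹' L) := by
  intro z p s l r hz hl
  have := h _ _ _ r.reverse l.reverse hz.reverse (by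
    filter_upwards [hl] with N h
    simpa using h)
  rw [← hasPeriod_reverse, ← hasPeriod_reverse (w := s ++ r)]
  simpa [or_comm] using this

theorem FactorClosed.reverse (h : FactorClosed L) : FactorClosed (List.reverse ⁻¹' L) :=
  fun w hw w' hw' => h w.reverse hw w'.reverse (by simpa using hw')

theorem infix_append_of_suffix_of_prefix {a b a' b' m : List B} (ha : a' <:+ a) (hb : b' <+: b) :
    a' ++ m ++ b' <:+: a ++ m ++ b := by
  obtain ⟨t, rfl⟩ := ha
  obtain ⟨t', rfl⟩ := hb
  exact ⟨t, t', by simp⟩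

theorem Simple.append (hL : FactorClosed L) (hT : NoBrokenRun P d L) (h : Simple P d v)
    (h' : Simple P d v') (hvv : ∀ᶠ N in atTop, v N ++ v' N ∈ L) :
    Simple P d (fun N => v N ++ v' N) := by
  obtain ⟨z₁, z₂, p₁, s₁, p₂, s₂, u, hz₁, hz₂, hv⟩ := h
  obtain ⟨z₃, z₄, p₃, s₃, p₄, s₄, u', hz₃, hz₄, hv'⟩ := h'
  have key : ∀ᶠ N in atTop, v N ++ v' N = z₁ N ++ u ++ (z₂ N ++ z₃ N) ++ u' ++ z₄ N := by
    filter_upwards [hv, hv'] with N h1 h2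
    simp [h1, h2]
  have middle : ∀ {m : ℕ → List B} {pm sm : List B}, IsRun P d m pm sm →
      (∀ N, m N = z₂ N ++ z₃ N) → Simple P d (fun N => v N ++ v' N) := by
    intro m pm sm hm hmz
    have := hT m pm sm (s₁ ++ u) (u' ++ p₄) hm (by
      filter_upwards [key, hvv, hz₁.prefix_suffix, hz₄.prefix_suffix] with N h1 h2 h3 h4
      rw [h1, ← hmz] at h2
      refine hL _ h2 _ ?_
      have := infix_append_of_suffix_of_prefix (m := u ++ m N ++ u') h3.2 h4.1
      simpa using this)
    rcases this with h | h
    · obtain ⟨q, hq⟩ := hz₁.append_run hm h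
      refine ⟨_, z₄, _, _, _, _, u', Or.inl hq, hz₄, ?_⟩
      filter_upwards [key] with N h1
      simp [h1, hmz]
    · obtain ⟨q, hq⟩ := hm.append_optRun (u := u') hz₄ (by simpa using h)
      refine ⟨z₁, _, _, _, _, _, u, hz₁, Or.inl hq, ?_⟩
      filter_upwards [key] with N h1
      simp [h1, hmz]
  rcases id hz₂ with r₂ | ⟨e₂, rfl, rfl⟩
  · rcases id hz₃ with r₃ | ⟨e₃, rfl, rfl⟩
    · by_cases hj : (s₂ ++ [] ++ p₃).HasPeriod P
      · exact middle (r₂.append_run r₃ hj) (by simp)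
      · have h1 := hT z₂ p₂ s₂ (s₁ ++ u) p₃ r₂ (by
          filter_upwards [key, hvv, hz₁.prefix_suffix, hz₃.prefix_suffix] with N h1 h2 h3 h4
          rw [h1] at h2
          refine hL _ h2 _ ?_
          have := infix_append_of_suffix_of_prefix (m := u ++ z₂ N) h3.2
            (h4.1.trans (List.prefix_append (z₃ N) (u' ++ z₄ N)))
          simpa using this)
        have h2 := hT z₃ p₃ s₃ s₂ (u' ++ p₄) r₃ (by
          filter_upwards [key, hvv, hz₂.prefix_suffix, hz₄.prefix_suffix] with N h1 h2 h3 h4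
          rw [h1] at h2
          refine hL _ h2 _ ?_
          have := infix_append_of_suffix_of_prefix (m := z₃ N ++ u')
            (h3.2.trans (List.suffix_append (z₁ N ++ u) (z₂ N))) h4.1
          simpa using this)
        obtain ⟨q, hq⟩ := hz₁.append_run r₂ (h1.resolve_right (by simpa using hj))
        obtain ⟨q', hq'⟩ := r₃.append_optRun (u := u') hz₄
          (by simpa using h2.resolve_left (by simpa using hj))
        refine ⟨_, _, _, _, _, _, [], Or.inl hq, Or.inl hq', ?_⟩
        filter_upwards [key] with N h1
        simp [h1]
    · exact middle r₂ (by simp [e₃])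
  · rcases id hz₃ with r₃ | ⟨e₃, rfl, rfl⟩
    · exact middle r₃ (by simp [e₂])
    · refine ⟨z₁, z₄, _, _, _, _, u ++ u', hz₁, hz₄, ?_⟩
      filter_upwards [key] with N h1
      simp [h1, e₂, e₃]

end Runs

section Sums

variable {B : Type*} {P d : ℕ} {L : Set (List B)}

theorem Simple.exists_suffix {v : ℕ → List B} (h : Simple P d v)
    (hlen : Tendsto (fun N => (v N).length) atTop atTop) :
    ∃ s : List B, s.length = P ∧ ∀ᶠ N in atTop, s <:+ v N := by
  obtain ⟨z, z', p, s, p', s', u, hz, hz', hv⟩ := h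
  rcases hz' with r' | ⟨e', rfl, rfl⟩
  · refine ⟨s', r'.length_suffix, ?_⟩
    filter_upwards [hv, r'.eventually_run] with N h1 h2
    rw [h1]
    exact h2.2.1.trans (List.suffix_append _ _)
  · rcases hz with r | ⟨e, rfl, rfl⟩
    · refine ⟨(s ++ u).drop u.length, by simp [r.length_suffix], ?_⟩
      filter_upwards [hv, r.eventually_run] with N h1 h2
      refine (List.drop_suffix _ _).trans ?_
      obtain ⟨t, ht⟩ := h2.2.1
      exact ⟨t, by rw [h1, ← ht]; simp [e']⟩
    · obtain ⟨N, h1, h2⟩ := (hv.and (hlen.eventually_gt_atTop u.length)).exists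
      simp [h1, e, e'] at h2

theorem isRun_of_sum {v Z : ℕ → List B} {s : List B} {N₀ : ℕ}
    (hZ : ∀ N, N₀ ≤ N → Z (N + 1) = Z N ++ v N)
    (hv : EvPoly d (fun N => ((v N).length : ℤ))) (hs : s.length = P)
    (hsZ : ∀ᶠ N in atTop, s <:+ Z N) (hper : ∀ᶠ N in atTop, (Z N).HasPeriod P)
    (hlen : Tendsto (fun N => (Z N).length) atTop atTop) :
    ∃ p, IsRun P (d + 1) Z p s := by
  have hpre : ∀ N, N₀ ≤ N → ∀ M, N ≤ M → Z N <+: Z M := by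
    intro N hN M hM
    induction M, hM using Nat.le_induction with
    | base => exact List.prefix_rfl
    | succ M hM ih =>
      rw [hZ M (by omega)]
      exact ih.trans (List.prefix_append _ _)
  obtain ⟨N₁, h1, h2⟩ := ((eventually_ge_atTop N₀).and (hlen.eventually_ge_atTop P)).exists
  refine ⟨(Z N₁).take P, by simpa using h2, hs, ?_, ?_, hlen⟩
  · filter_upwards [hsZ, hper, eventually_ge_atTop N₁] with N h3 h4 h5
    exact ⟨(List.take_prefix _ _).trans (hpre _ h1 _ h5), h3, h4⟩
  · change EvPoly d (fun N => ((Z (N + 1)).length : ℤ) - (Z N).length)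
    refine EvPoly.congr hv ?_
    filter_upwards [eventually_ge_atTop N₀] with N hN
    simp [hZ N hN]

theorem hasPeriod_sum {v Z : ℕ → List B} {N₀ : ℕ} (h₀ : Z N₀ = [])
    (hZ : ∀ N, N₀ ≤ N → Z (N + 1) = Z N ++ v N) (hv : ∀ N, N₀ ≤ N → P ≤ (v N).length)
    (hvv : ∀ N, N₀ ≤ N → (v N ++ v (N + 1)).HasPeriod P) (N : ℕ) (hN : N₀ ≤ N) :
    (Z (N + 1)).HasPeriod P := by
  induction N, hN using Nat.le_induction with
  | base =>
    rw [hZ _ le_rfl, h₀]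
    exact (hvv N₀ le_rfl).infix (List.prefix_append _ _).isInfix
  | succ N hN ih =>
    rw [hZ _ (by omega), hZ _ hN]
    exact List.HasPeriod.glue (hv N hN) (by rwa [← hZ _ hN]) (hvv N hN)

theorem tendsto_length_of_append {v Z : ℕ → List B} {N₀ : ℕ}
    (hZ : ∀ N, N₀ ≤ N → Z (N + 1) = Z N ++ v N) (hv : ∀ N, N₀ ≤ N → v N ≠ []) :
    Tendsto (fun N => (Z N).length) atTop atTop := by
  have key : ∀ N, N₀ ≤ N → N - N₀ ≤ (Z N).length := by
    intro N hN
    induction N, hN using Nat.le_induction with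
    | base => simp
    | succ N hN ih =>
      have := List.length_pos_of_ne_nil (hv N hN)
      rw [hZ N hN, List.length_append]
      omega
  refine tendsto_atTop_mono' _ ?_ (tendsto_sub_atTop_nat N₀)
  filter_upwards [eventually_ge_atTop N₀] with N hN using key N hN

/-- The joint of consecutive words of a simple family, when it is not constant, is a run. -/
theorem Simple.exists_joint_run {z z' : ℕ → List B} {p s p' s' u : List B} (hL : FactorClosed L)
    (hT : NoBrokenRun P d L) (hz : OptRun P d z p s) (hz' : OptRun P d z' p' s')
    (hne : IsRun P d z p s ∨ IsRun P d z' p' s')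
    (hmem : ∀ᶠ N in atTop, (z N ++ u ++ z' N) ++ (z (N + 1) ++ u ++ z' (N + 1)) ++
      (z (N + 2) ++ u ++ z' (N + 2)) ++ (z (N + 3) ++ u ++ z' (N + 3)) ∈ L) :
    ∃ pm sm, IsRun P d (fun N => z' N ++ z (N + 1)) pm sm := by
  rcases id hz with r | ⟨e, rfl, rfl⟩
  · rcases id hz' with r' | ⟨e', rfl, rfl⟩
    · suffices hj : (s' ++ [] ++ p).HasPeriod P by
        exact ⟨_, _, by simpa using r'.append_run r.succ_arg hj⟩
      by_contra hj
      have hj : ¬ (s' ++ p).HasPeriod P := by simpa using hj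
      have ht := (tendsto_add_atTop_nat 1).eventually hz'.prefix_suffix
      have h1 := hT (fun N => z (N + 1)) p s s' (u ++ p') r.succ_arg (by
        filter_upwards [hmem, hz'.prefix_suffix, ht] with N h1 h2 h3
        refine hL _ h1 _ ?_
        have := infix_append_of_suffix_of_prefix (m := z (N + 1) ++ u)
          (h2.2.trans (List.suffix_append (z N ++ u) (z' N)))
          (h3.1.trans (List.prefix_append (z' (N + 1))
            ((z (N + 2) ++ u ++ z' (N + 2)) ++ (z (N + 3) ++ u ++ z' (N + 3)))))
        simpa using this)
      have h1 := r.succ_arg.append_run r'.succ_arg (u := u)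
        (by simpa using h1.resolve_left hj)
      have ht2 := (tendsto_add_atTop_nat 2).eventually hz.prefix_suffix
      have h2 := hT _ p s' s' p h1 (by
        filter_upwards [hmem, hz'.prefix_suffix, ht2] with N h1 h2 h3
        refine hL _ h1 _ ?_
        have := infix_append_of_suffix_of_prefix (m := z (N + 1) ++ u ++ z' (N + 1))
          (h2.2.trans (List.suffix_append (z N ++ u) (z' N)))
          (h3.1.trans (List.prefix_append (z (N + 2))
            (u ++ z' (N + 2) ++ (z (N + 3) ++ u ++ z' (N + 3)))))
        simpa using this)
      exact hj (or_self_iff.1 h2)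
    · exact ⟨_, _, by simpa [e'] using r.succ_arg⟩
  · rcases hne with r | r'
    · obtain ⟨N, hN⟩ := (r.tendsto_length.eventually_gt_atTop 0).exists
      simp [e] at hN
    · exact ⟨_, _, by simpa [e] using r'⟩

/-- The words of a nonconstant simple family, when concatenated, form a periodic word. -/
theorem Simple.exists_hasPeriod {z z' : ℕ → List B} {p s p' s' u : List B} (hL : FactorClosed L)
    (hT : NoBrokenRun P d L) (hz : OptRun P d z p s) (hz' : OptRun P d z' p' s')
    (hne : IsRun P d z p s ∨ IsRun P d z' p' s')
    (hmem : ∀ᶠ N in atTop, (z N ++ u ++ z' N) ++ (z (N + 1) ++ u ++ z' (N + 1)) ++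
      (z (N + 2) ++ u ++ z' (N + 2)) ++ (z (N + 3) ++ u ++ z' (N + 3)) ∈ L) :
    ∀ᶠ N in atTop, ((z N ++ u ++ z' N) ++ (z (N + 1) ++ u ++ z' (N + 1))).HasPeriod P := by
  obtain ⟨pm, sm, hm⟩ := Simple.exists_joint_run hL hT hz hz' hne hmem
  have ht := (tendsto_add_atTop_nat 2).eventually hm.eventually_run
  have h1 := hT _ pm sm (sm ++ u) (u ++ pm) hm.succ_arg (by
    filter_upwards [hmem, hm.eventually_run, ht] with N h1 h2 h3
    refine hL _ h1 _ ?_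
    have := infix_append_of_suffix_of_prefix (m := u ++ (z' (N + 1) ++ z (N + 2)) ++ u)
      (h2.2.1.trans (List.suffix_append (z N ++ u) (z' N ++ z (N + 1))))
      (h3.1.trans (List.prefix_append (z' (N + 2) ++ z (N + 3)) (u ++ z' (N + 3))))
    simpa [add_assoc] using this)
  have h1 : (sm ++ u ++ pm).HasPeriod P := by
    rcases h1 with h | h <;> simpa using h
  have h2 := (hm.append_run hm.succ_arg h1).append_run hm.succ_arg.succ_arg h1
  have := (tendsto_sub_atTop_nat 1).eventually h2.eventually_run
  filter_upwards [this, eventually_ge_atTop 1] with N h3 h4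
  obtain ⟨N, rfl⟩ := Nat.exists_eq_add_of_le' h4
  refine h3.2.2.infix ⟨z' N, z (N + 3), ?_⟩
  simp [add_assoc]

theorem exists_prefix_of_append {v V : ℕ → List B} (hV : ∀ N, V (N + 1) = V N ++ v N) (N₀ : ℕ) :
    ∃ Z : ℕ → List B, Z N₀ = [] ∧ (∀ N, N₀ ≤ N → Z (N + 1) = Z N ++ v N) ∧
      ∀ N, N₀ ≤ N → V N = V N₀ ++ Z N := by
  have key : ∀ N, N₀ ≤ N → V N = V N₀ ++ (V N).drop (V N₀).length := by
    intro N hN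
    induction N, hN using Nat.le_induction with
    | base => simp
    | succ N hN ih => rw [hV, ih]; simp
  refine ⟨fun N => (V N).drop (V N₀).length, by simp, fun N hN => ?_, key⟩
  have := key N hN
  simp only [hV]
  rw [this]
  simp

theorem List.HasPeriod.eventually_const_sum (hP : 0 < P) {v Z : ℕ → List B} {u : List B} {N₀ : ℕ}
    (h₀ : Z N₀ = []) (hZ : ∀ N, N₀ ≤ N → Z (N + 1) = Z N ++ v N) (hv : ∀ N, N₀ ≤ N → v N = u)
    (hu : u ≠ []) (hd : u.length ∣ P) : ∃ p s, IsRun P 1 Z p s := by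
  have hlen : Tendsto (fun N => (Z N).length) atTop atTop :=
    tendsto_length_of_append hZ (by simpa +contextual [hv] using fun _ _ => hu)
  have hpow : ∀ N, N₀ ≤ N → Z N = (List.replicate (N - N₀) u).flatten := by
    intro N hN
    induction N, hN using Nat.le_induction with
    | base => simp [h₀]
    | succ N hN ih =>
      rw [hZ N hN, ih, hv N hN, Nat.sub_add_comm hN, List.replicate_succ']
      simp
  have hper : ∀ N, N₀ ≤ N → (Z (N + 1)).HasPeriod P := by
    intro N hN
    refine (hasPeriod_sum h₀ hZ (P := u.length) (by simp +contextual [hv]) ?_ N hN).dvd hd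
    intro N hN
    rw [hv N hN, hv (N + 1) (by omega), hasPeriod_iff_lt]
    intro i hi
    rw [List.length_append] at hi
    rw [List.getElem?_append_left (by omega), List.getElem?_append_right (by omega)]
    congr 1
    omega
  obtain ⟨N₁, h1, h2⟩ := ((eventually_ge_atTop N₀).and (hlen.eventually_ge_atTop P)).exists
  refine (isRun_of_sum (s := (Z N₁).drop ((Z N₁).length - P)) hZ (d := 0)
    ⟨u.length, ?_⟩ ?_ ?_ ?_ hlen).imp fun p h => ⟨_, h⟩
  · filter_upwards [eventually_ge_atTop N₀] with N hN
    rw [hv N hN]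
  · simp; omega
  · filter_upwards [eventually_ge_atTop N₁] with N hN
    refine (List.drop_suffix _ _).trans ?_
    rw [hpow N (by omega), hpow N₁ h1]
    obtain ⟨m, hm⟩ := Nat.exists_eq_add_of_le (show N₁ - N₀ ≤ N - N₀ by omega)
    rw [hm, add_comm, List.replicate_add, List.flatten_append]
    exact List.suffix_append _ _
  · filter_upwards [eventually_ge_atTop (N₀ + 1)] with N hN
    obtain ⟨N, rfl⟩ := Nat.exists_eq_add_of_le' (show 1 ≤ N by omega)
    exact hper N (by omega)

/-- Concatenating the words of a simple family yields a run, up to a constant prefix. -/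
theorem Simple.sum {v V : ℕ → List B} (hP : 0 < P) (hL : FactorClosed L) (hT : NoBrokenRun P d L)
    (h : Simple P d v) (hmem : ∀ᶠ N in atTop, v N ++ v (N + 1) ++ v (N + 2) ++ v (N + 3) ∈ L)
    (hdvd : ∀ u ≠ [], (∀ᶠ N in atTop, v N = u) → u.length ∣ P)
    (hV : ∀ N, V (N + 1) = V N ++ v N) :
    ∃ c Z p s, OptRun P (d + 1) Z p s ∧ ∀ᶠ N in atTop, V N = c ++ Z N := by
  obtain ⟨z, z', p, s, p', s', u, hz, hz', hv⟩ := id h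
  by_cases hne : IsRun P d z p s ∨ IsRun P d z' p' s'
  · have hlen : Tendsto (fun N => (v N).length) atTop atTop := by
      rcases hne with r | r
      · refine tendsto_atTop_mono' _ ?_ r.tendsto_length
        filter_upwards [hv] with N h
        simp [h]
      · refine tendsto_atTop_mono' _ ?_ r.tendsto_length
        filter_upwards [hv] with N h
        simp [h]; omega
    obtain ⟨t, ht, htv⟩ := h.exists_suffix hlen
    have hv1 := (tendsto_add_atTop_nat 1).eventually hv
    have hv2 := (tendsto_add_atTop_nat 2).eventually hv
    have hv3 := (tendsto_add_atTop_nat 3).eventually hv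
    have hper := Simple.exists_hasPeriod (u := u) hL hT hz hz' hne (by
      filter_upwards [hmem, hv, hv1, hv2, hv3] with N h h0 h1 h2 h3
      rw [h0, h1, h2, h3] at h
      exact h)
    have : ∀ᶠ N in atTop, (v N ++ v (N + 1)).HasPeriod P ∧ P + 1 ≤ (v N).length ∧ t <:+ v N := by
      filter_upwards [hper, hv, hv1, hlen.eventually_ge_atTop (P + 1), htv] with N h h0 h1 h2 h3
      rw [← h0, ← h1] at h
      exact ⟨h, h2, h3⟩
    obtain ⟨N₀, hN₀⟩ := eventually_atTop.1 this
    obtain ⟨Z, hZ₀, hZ, hVZ⟩ := exists_prefix_of_append hV N₀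
    obtain ⟨q, hq⟩ := isRun_of_sum hZ h.evPoly ht (by
      filter_upwards [eventually_ge_atTop (N₀ + 1)] with N hN
      obtain ⟨N, rfl⟩ := Nat.exists_eq_add_of_le' (show 1 ≤ N by omega)
      rw [hZ N (by omega)]
      exact (hN₀ N (by omega)).2.2.trans (List.suffix_append _ _)) (by
      filter_upwards [eventually_ge_atTop (N₀ + 1)] with N hN
      obtain ⟨N, rfl⟩ := Nat.exists_eq_add_of_le' (show 1 ≤ N by omega)
      exact hasPeriod_sum hZ₀ hZ (fun N hN => by have := (hN₀ N hN).2.1; omega)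
        (fun N hN => (hN₀ N hN).1) N (by omega))
      (tendsto_length_of_append hZ fun N hN h => by
        have := (hN₀ N hN).2.1
        simp [h] at this)
    exact ⟨V N₀, Z, q, t, Or.inl hq, eventually_atTop.2 ⟨N₀, hVZ⟩⟩
  · rw [not_or] at hne
    obtain ⟨e, rfl, rfl⟩ := hz.resolve_left hne.1
    obtain ⟨e', rfl, rfl⟩ := hz'.resolve_left hne.2
    simp only [e, e', List.nil_append, List.append_nil] at hv
    obtain ⟨N₀, hN₀⟩ := eventually_atTop.1 hv
    obtain ⟨Z, hZ₀, hZ, hVZ⟩ := exists_prefix_of_append hV N₀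
    by_cases hu : u = []
    · refine ⟨V N₀, fun _ => [], [], [], Or.inr (by simp), ?_⟩
      filter_upwards [eventually_ge_atTop N₀] with N hN
      induction N, hN using Nat.le_induction with
      | base => simp
      | succ N hN ih => rw [hV, ih, hN₀ N hN, hu]; simp
    · obtain ⟨q, t, hq⟩ := List.HasPeriod.eventually_const_sum hP hZ₀ hZ hN₀ hu (hdvd u hu hv)
      exact ⟨V N₀, Z, q, t, Or.inl (hq.mono (by omega)), eventually_atTop.2 ⟨N₀, hVZ⟩⟩

/-- The mirror image of `Simple.sum`. -/
theorem Simple.sum_left {v V : ℕ → List B} (hP : 0 < P) (hL : FactorClosed L)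
    (hT : NoBrokenRun P d L) (h : Simple P d v)
    (hmem : ∀ᶠ N in atTop, v (N + 3) ++ v (N + 2) ++ v (N + 1) ++ v N ∈ L)
    (hdvd : ∀ u ≠ [], (∀ᶠ N in atTop, v N = u) → u.length ∣ P)
    (hV : ∀ N, V (N + 1) = v N ++ V N) :
    ∃ c Z p s, OptRun P (d + 1) Z p s ∧ ∀ᶠ N in atTop, V N = Z N ++ c := by
  obtain ⟨c, Z, p, s, hZ, hVZ⟩ := Simple.sum (V := fun N => (V N).reverse) hP hL.reverse hT.reverse
    h.reverse (by
      filter_upwards [hmem] with N h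
      simpa using h) (by
      intro u hu h
      rw [← List.length_reverse]
      refine hdvd u.reverse (by simpa using hu) ?_
      filter_upwards [h] with N h
      simp [← h]) (by simp [hV])
  refine ⟨c.reverse, _, _, _, hZ.reverse, ?_⟩
  filter_upwards [hVZ] with N h
  rw [← List.reverse_reverse (V N), h]
  simp

end Sums

section Stability

variable {B : Type*} {P d : ℕ} {ρ : ℕ → ℕ} {L : Set (List B)}

/-- Prefixes of `w N` which are shorter than `ρ N`, up to a constant, are prefixes of all but
finitely many words of the family `w`. -/
def PrefixStable (ρ : ℕ → ℕ) (w : ℕ → List B) : Prop :=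
  ∃ N₀ c₀, ∀ N, N₀ ≤ N → ∀ r, r <+: w N → r.length + c₀ ≤ ρ N → ∀ᶠ M in atTop, r <+: w M

/-- A family of words which start with a run followed by a break of the period. -/
def RunThenBreak (P d : ℕ) (ρ : ℕ → ℕ) (v : ℕ → List B) : Prop :=
  ∃ z p s w r, IsRun P d z p s ∧ PrefixStable ρ w ∧ (∀ᶠ N in atTop, v N = z N ++ w N) ∧
    (∀ᶠ N in atTop, r <+: w N) ∧ ¬ (s ++ r).HasPeriod P

variable {w v z : ℕ → List B} {p s u : List B}

theorem PrefixStable.congr (h : PrefixStable ρ w) (hv : ∀ᶠ N in atTop, v N = w N) :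
    PrefixStable ρ v := by
  obtain ⟨N₀, c₀, h⟩ := h
  obtain ⟨N₁, hN₁⟩ := eventually_atTop.1 hv
  refine ⟨max N₀ N₁, c₀, fun N hN r hr hl => ?_⟩
  rw [hN₁ N (by omega)] at hr
  filter_upwards [h N (by omega) r hr hl, hv] with M h1 h2
  rwa [h2]

theorem RunThenBreak.congr (h : RunThenBreak P d ρ w) (hv : ∀ᶠ N in atTop, v N = w N) :
    RunThenBreak P d ρ v := by
  obtain ⟨z, p, s, w', r, h1, h2, h3, h4⟩ := h
  refine ⟨z, p, s, w', r, h1, h2, ?_, h4⟩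
  filter_upwards [h3, hv] with N h h'
  rw [h', h]

theorem prefixStable_nil : PrefixStable ρ (fun _ => ([] : List B)) :=
  ⟨0, 0, fun _ _ _ hr _ => Eventually.of_forall fun _ => hr⟩

theorem prefix_append_cases {r x y : List B} (h : r <+: x ++ y) :
    r <+: x ∨ ∃ r', r = x ++ r' ∧ r' <+: y := by
  rcases List.prefix_or_prefix_of_prefix h (List.prefix_append x y) with h' | ⟨t, rfl⟩
  · exact Or.inl h'
  · exact Or.inr ⟨t, rfl, (List.prefix_append_right_inj x).1 h⟩

theorem PrefixStable.const_append (h : PrefixStable ρ w) (u : List B) :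
    PrefixStable ρ (fun N => u ++ w N) := by
  obtain ⟨N₀, c₀, h⟩ := h
  refine ⟨N₀, c₀, fun N hN r hr hl => ?_⟩
  rcases prefix_append_cases hr with h' | ⟨r', rfl, h'⟩
  · exact Eventually.of_forall fun M => h'.trans (List.prefix_append _ _)
  · filter_upwards [h N hN r' h' (by simp at hl; omega)] with M hM
    simpa using hM

theorem List.HasPeriod.prefix_of_prefix (hP : 0 < P) {x y q : List B} (hx : x.HasPeriod P)
    (hy : y.HasPeriod P) (hq : q.length = P) (hqx : q <+: x ∨ x <+: q) (hqy : q <+: y)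
    (hl : x.length ≤ y.length) : x <+: y := by
  rcases hqx with hqx | hqx
  swap
  · exact hqx.trans hqy
  rw [List.prefix_iff_getElem?]
  intro i hi
  have hm : i % P < q.length := (Nat.mod_lt i hP).trans_eq hq.symm
  rw [List.hasPeriod_iff_forall_getElem?_mod] at hx hy
  rw [← List.getElem?_eq_getElem hi, hx i hi, hy i (by omega)]
  obtain ⟨t, rfl⟩ := hqx
  obtain ⟨t', rfl⟩ := hqy
  rw [List.getElem?_append_left hm, List.getElem?_append_left hm]

theorem IsRun.eventually_prefix (hP : 0 < P) (h : IsRun P d z p s) {r : List B}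
    (hr : r.HasPeriod P) (hpr : p <+: r ∨ r <+: p) : ∀ᶠ M in atTop, r <+: z M := by
  filter_upwards [h.eventually_run, h.tendsto_length.eventually_ge_atTop r.length] with M h1 h2
  exact hr.prefix_of_prefix hP h1.2.2 h.length_prefix hpr h1.1 h2

theorem IsRun.append_stable (hP : 0 < P) (h : IsRun P d z p s) (hw : PrefixStable ρ w)
    (hs : ∀ r, (∀ᶠ N in atTop, r <+: w N) → (s ++ r).HasPeriod P) :
    PrefixStable ρ (fun N => z N ++ w N) := by
  obtain ⟨N₀, c₀, hw⟩ := hw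
  obtain ⟨N₁, hN₁⟩ := eventually_atTop.1 h.eventually_run
  refine ⟨max N₀ N₁, c₀, fun N hN r hr hl => ?_⟩
  obtain ⟨h1, h2, h3⟩ := hN₁ N (by omega)
  suffices hr : r.HasPeriod P ∧ (p <+: r ∨ r <+: p) by
    filter_upwards [h.eventually_prefix hP hr.1 hr.2] with M hM
      using hM.trans (List.prefix_append _ _)
  rcases prefix_append_cases hr with h' | ⟨r', rfl, h'⟩
  · exact ⟨h3.infix h'.isInfix, List.prefix_or_prefix_of_prefix h1 h'⟩
  · refine ⟨h3.append_of_suffix h2 h.length_suffix (hs r' ?_),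
      Or.inl (h1.trans (List.prefix_append _ _))⟩
    exact hw N (by omega) r' h' (by simp at hl; omega)

/-- A sufficiently long run makes a family stable. -/
theorem IsRun.append_prefixStable (hP : 0 < P) (h : IsRun P d z p s) (c : ℕ)
    (hl : ∀ᶠ N in atTop, ρ N ≤ (z N).length + c) (w : ℕ → List B) :
    PrefixStable ρ (fun N => z N ++ w N) := by
  obtain ⟨N₁, hN₁⟩ := eventually_atTop.1 (h.eventually_run.and hl)
  refine ⟨N₁, c, fun N hN r hr hrl => ?_⟩
  obtain ⟨⟨h1, h2, h3⟩, h4⟩ := hN₁ N hN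
  have h' : r <+: z N :=
    List.prefix_of_prefix_length_le hr (List.prefix_append _ _) (by omega)
  filter_upwards [h.eventually_prefix hP (h3.infix h'.isInfix)
    (List.prefix_or_prefix_of_prefix h1 h')] with M hM using hM.trans (List.prefix_append _ _)

theorem IsRun.stable_or_break (hP : 0 < P) (h : IsRun P d z p s) (hw : PrefixStable ρ w) :
    PrefixStable ρ (fun N => z N ++ w N) ∨
      ∃ r, (∀ᶠ N in atTop, r <+: w N) ∧ ¬ (s ++ r).HasPeriod P := by
  by_cases hs : ∀ r, (∀ᶠ N in atTop, r <+: w N) → (s ++ r).HasPeriod P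
  · exact Or.inl (h.append_stable hP hw hs)
  · push Not at hs
    exact Or.inr hs

theorem OptRun.append_stable_or_break (hP : 0 < P) (h : OptRun P d z p s)
    (hw : PrefixStable ρ w) (hv : ∀ᶠ N in atTop, v N = z N ++ w N) :
    PrefixStable ρ v ∨ RunThenBreak P d ρ v := by
  rcases h with h | ⟨h, rfl, rfl⟩
  · rcases h.stable_or_break hP hw with h' | ⟨r, h1, h2⟩
    · exact Or.inl (h'.congr hv)
    · exact Or.inr ⟨z, p, s, w, r, h, hw, hv, h1, h2⟩
  · exact Or.inl (hw.congr (by simpa [h] using hv))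

theorem Simple.append_stable (hP : 0 < P) (hL : FactorClosed L) (hT : NoBrokenRun P d L)
    (h : Simple P d v) (hw : PrefixStable ρ w) (hvw : ∀ᶠ N in atTop, v N ++ w N ∈ L) :
    PrefixStable ρ (fun N => v N ++ w N) ∨ RunThenBreak P d ρ (fun N => v N ++ w N) := by
  obtain ⟨z, z', p, s, p', s', u, hz, hz', hv⟩ := h
  rcases hz' with r' | ⟨e', rfl, rfl⟩
  · rcases r'.stable_or_break hP hw with h' | ⟨r, h1, h2⟩
    · refine hz.append_stable_or_break hP (h'.const_append u) ?_
      filter_upwards [hv] with N h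
      simp [h]
    · have h3 := hT z' p' s' (s ++ u) r r' (by
        filter_upwards [hv, hvw, hz.prefix_suffix, h1] with N h3 h4 h5 h6
        rw [h3] at h4
        refine hL _ h4 _ ?_
        have := infix_append_of_suffix_of_prefix (m := u ++ z' N) h5.2 h6
        simpa using this)
      obtain ⟨q, hq⟩ := hz.append_run r' (h3.resolve_right h2)
      refine Or.inr ⟨_, _, _, w, r, hq, hw, ?_, h1, h2⟩
      filter_upwards [hv] with N h
      simp [h]
  · refine hz.append_stable_or_break hP (hw.const_append u) ?_
    filter_upwards [hv] with N h
    simp [h, e']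

end Stability

section Cuts

variable {B : Type*} {P d : ℕ} {ρ : ℕ → ℕ} {L : Set (List B)}

/-- The word `w` occurs across the cut between `x` and `y`. -/
def IsCut (x y w : List B) : Prop :=
  ∃ w₁ w₂, w₁ ≠ [] ∧ w₂ ≠ [] ∧ w = w₁ ++ w₂ ∧ w₁ <:+ x ∧ w₂ <+: y

theorem IsCut.reverse {x y w : List B} (h : IsCut x y w) :
    IsCut y.reverse x.reverse w.reverse := by
  obtain ⟨w₁, w₂, h1, h2, rfl, h3, h4⟩ := h
  exact ⟨w₂.reverse, w₁.reverse, by simpa, by simpa, by simp, by simpa, by simpa⟩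

theorem ncard_le_of_index {α : Type*} {S : Set α} {m : ℕ} (R : ℕ → α → Prop)
    (hS : ∀ w ∈ S, ∃ i < m, R i w) (hR : ∀ i w w', R i w → R i w' → w = w') :
    S.Finite ∧ S.ncard ≤ m := by
  choose! f hf hfR using hS
  have hinj : Set.InjOn f S := fun w hw w' hw' h =>
    hR (f w) w w' (hfR w hw) (h ▸ hfR w' hw')
  have hmaps : Set.MapsTo f S (Set.Iio m) := fun w hw => hf w hw
  refine ⟨Set.Finite.of_injOn hmaps hinj (Set.finite_Iio m), ?_⟩
  have := Set.ncard_le_ncard_of_injOn f hmaps hinj (Set.finite_Iio m)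
  rwa [← Finset.coe_Iio, Set.ncard_coe_finset, Nat.card_Iio] at this

theorem ncard_isCut_le (x y : List B) (n : ℕ) :
    {w | w.length = n ∧ IsCut x y w}.Finite ∧ {w | w.length = n ∧ IsCut x y w}.ncard ≤ n + 1 := by
  refine ncard_le_of_index
    (fun i w => ∃ w₁ w₂, w₁.length = i ∧ w₁.length + w₂.length = n ∧ w = w₁ ++ w₂ ∧
      w₁ <:+ x ∧ w₂ <+: y) ?_ ?_
  · rintro w ⟨hw, w₁, w₂, -, -, rfl, h1, h2⟩
    rw [List.length_append] at hw
    exact ⟨w₁.length, by omega, w₁, w₂, rfl, hw, rfl, h1, h2⟩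
  · rintro i w w' ⟨w₁, w₂, h1, h2, rfl, h3, h4⟩ ⟨w₁', w₂', h1', h2', rfl, h3', h4'⟩
    rw [(List.suffix_of_suffix_length_le h3 h3' (by omega)).eq_of_length (by omega),
      (List.prefix_of_prefix_length_le h4 h4' (by omega)).eq_of_length (by omega)]

theorem ncard_hasPeriod_le [Fintype B] (hP : 0 < P) (n : ℕ) :
    {w : List B | w.length = n ∧ w.HasPeriod P}.Finite ∧
      {w : List B | w.length = n ∧ w.HasPeriod P}.ncard ≤ (Fintype.card B + 1) ^ P := by
  classical
  let f : List B → Fin P → Option B := fun w i => w[(i : ℕ)]?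
  have hinj : Set.InjOn f {w : List B | w.length = n ∧ w.HasPeriod P} := by
    rintro w ⟨hw, hp⟩ w' ⟨hw', hp'⟩ h
    rw [List.hasPeriod_iff_forall_getElem?_mod] at hp hp'
    refine List.ext_getElem? fun i => ?_
    by_cases hi : i < n
    · rw [hp i (by omega), hp' i (by omega)]
      exact congrFun h ⟨i % P, Nat.mod_lt i hP⟩
    · rw [List.getElem?_eq_none (by omega), List.getElem?_eq_none (by omega)]
  refine ⟨Set.Finite.of_injOn (Set.mapsTo_univ f _) hinj Set.finite_univ, ?_⟩
  have := Set.ncard_le_ncard_of_injOn f (Set.mapsTo_univ f _) hinj Set.finite_univ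
  simpa [Set.ncard_univ, Nat.card_eq_fintype_card] using this

/-- The words of length `n` across the cuts between `X N` and `Y N`, for large `N`. -/
def cutWords (ρ : ℕ → ℕ) (X Y : ℕ → List B) (N₀ c₀ n : ℕ) : Set (List B) :=
  {w | w.length = n ∧ ∃ N, N₀ ≤ N ∧ n + c₀ ≤ ρ N ∧ IsCut (X N) (Y N) w}

/-- There are at most linearly many words of length `n` across the cuts between `X N` and
`Y N`, for large `N`. -/
def FewCuts (ρ : ℕ → ℕ) (X Y : ℕ → List B) : Prop :=
  ∃ C N₀ c₀, ∀ n, (cutWords ρ X Y N₀ c₀ n).Finite ∧ (cutWords ρ X Y N₀ c₀ n).ncard ≤ C * (n + 1)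

variable {X Y : ℕ → List B}

theorem FewCuts.of_reverse (h : FewCuts ρ (fun N => (Y N).reverse) (fun N => (X N).reverse)) :
    FewCuts ρ X Y := by
  obtain ⟨C, N₀, c₀, h⟩ := h
  refine ⟨C, N₀, c₀, fun n => ?_⟩
  have hinj : Set.InjOn List.reverse (cutWords ρ X Y N₀ c₀ n) := List.reverse_injective.injOn
  have hmaps : Set.MapsTo List.reverse (cutWords ρ X Y N₀ c₀ n)
      (cutWords ρ (fun N => (Y N).reverse) (fun N => (X N).reverse) N₀ c₀ n) := by
    rintro w ⟨hw, N, h1, h2, h3⟩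
    exact ⟨by simpa, N, h1, h2, h3.reverse⟩
  exact ⟨Set.Finite.of_injOn hmaps hinj (h n).1,
    (Set.ncard_le_ncard_of_injOn _ hmaps hinj (h n).1).trans (h n).2⟩

theorem FewCuts.of_stable (hX : PrefixStable ρ (fun N => (X N).reverse)) (hY : PrefixStable ρ Y) :
    FewCuts ρ X Y := by
  obtain ⟨N₁, c₁, hX⟩ := hX
  obtain ⟨N₂, c₂, hY⟩ := hY
  refine ⟨1, max N₁ N₂, max c₁ c₂, fun n => ?_⟩
  rw [one_mul]
  refine ncard_le_of_index
    (fun i w => ∃ w₁ w₂, w₁.length = i ∧ w₁.length + w₂.length = n ∧ w = w₁ ++ w₂ ∧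
      (∀ᶠ M in atTop, w₁ <:+ X M) ∧ ∀ᶠ M in atTop, w₂ <+: Y M) ?_ ?_
  · rintro w ⟨hw, N, hN, hn, w₁, w₂, -, -, rfl, h1, h2⟩
    rw [List.length_append] at hw
    refine ⟨w₁.length, by omega, w₁, w₂, rfl, hw, rfl, ?_, hY N (by omega) w₂ h2 (by omega)⟩
    simpa using hX N (by omega) w₁.reverse (by simpa) (by simp; omega)
  · rintro i w w' ⟨w₁, w₂, h1, h2, rfl, h3, h4⟩ ⟨w₁', w₂', h1', h2', rfl, h3', h4'⟩
    obtain ⟨M, h3, h4, h3', h4'⟩ := (h3.and (h4.and (h3'.and h4'))).exists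
    rw [(List.suffix_of_suffix_length_le h3 h3' (by omega)).eq_of_length (by omega),
      (List.prefix_of_prefix_length_le h4 h4' (by omega)).eq_of_length (by omega)]

theorem FewCuts.of_stable_of_break [Fintype B] (hP : 0 < P) (hL : FactorClosed L)
    (hT : NoBrokenRun P d L) (hXY : ∀ᶠ N in atTop, X N ++ Y N ∈ L)
    (hX : PrefixStable ρ (fun N => (X N).reverse)) (hY : RunThenBreak P d ρ Y) :
    FewCuts ρ X Y := by
  obtain ⟨z, p, s, w, r, hz, hw, hYz, hrw, hr⟩ := hY
  have hper : ∀ q, (∀ᶠ N in atTop, q <+: (X N).reverse) → (p.reverse ++ q).HasPeriod P := by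
    intro q hq
    have := hT z p s q.reverse r hz (by
      filter_upwards [hXY, hYz, hrw, hq] with N h1 h2 h3 h4
      rw [h2] at h1
      refine hL _ h1 _ ?_
      have := infix_append_of_suffix_of_prefix (m := z N)
        (show q.reverse <:+ X N by simpa using List.reverse_suffix.2 h4) h3
      simpa using this)
    have := this.resolve_right hr
    rw [← hasPeriod_reverse] at this
    simpa using this
  have hXz : PrefixStable ρ (fun N => (X N ++ z N).reverse) := by
    simpa using hz.reverse.append_stable hP hX hper
  obtain ⟨C, N₁, c₁, h1⟩ := FewCuts.of_stable hXz hw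
  obtain ⟨N₂, c₂, h2⟩ := hX
  obtain ⟨N₃, h3⟩ := eventually_atTop.1 (hYz.and hz.eventually_run)
  refine ⟨C + (Fintype.card B + 1) ^ P, max N₁ (max N₂ N₃), max c₁ c₂, fun n => ?_⟩
  have hsub : cutWords ρ X Y (max N₁ (max N₂ N₃)) (max c₁ c₂) n ⊆
      cutWords ρ (fun N => X N ++ z N) w N₁ c₁ n ∪ {w : List B | w.length = n ∧ w.HasPeriod P} := by
    rintro w ⟨hw, N, hN, hn, w₁, w₂, e1, e2, rfl, h4, h5⟩
    obtain ⟨h6, h7, h8, h9⟩ := h3 N (by omega)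
    rw [h6] at h5
    rcases prefix_append_cases h5 with h' | ⟨w₃, rfl, h'⟩
    · right
      refine ⟨hw, ?_⟩
      have h10 : (w₁ ++ p).HasPeriod P := by
        rw [← hasPeriod_reverse]
        simpa using hper w₁.reverse (h2 N (by omega) _ (by simpa)
          (by simp at hw ⊢; omega))
      refine (h9.append_of_prefix h7 hz.length_prefix h10).infix ?_
      exact ((List.prefix_append_right_inj w₁).2 h').isInfix
    · by_cases e3 : w₃ = []
      · right
        refine ⟨hw, ?_⟩
        subst e3
        have h10 : (w₁ ++ p).HasPeriod P := by
          rw [← hasPeriod_reverse]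
          simpa using hper w₁.reverse (h2 N (by omega) _ (by simpa)
            (by simp at hw ⊢; omega))
        simpa using h9.append_of_prefix h7 hz.length_prefix h10
      · left
        refine ⟨hw, N, by omega, by omega, w₁ ++ z N, w₃, by simp [e1], e3, by simp, ?_, h'⟩
        obtain ⟨t, ht⟩ := h4
        exact ⟨t, by simp [← ht]⟩
  have hfin := (h1 n).1.union (ncard_hasPeriod_le (B := B) hP n).1
  refine ⟨hfin.subset hsub, (Set.ncard_le_ncard hsub hfin).trans
    ((Set.ncard_union_le _ _).trans ?_)⟩
  have := (ncard_hasPeriod_le (B := B) hP n).2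
  have := (h1 n).2
  nlinarith

theorem RunThenBreak.not_both (hL : FactorClosed L)
    (hT : NoBrokenRun P d L) (hXY : ∀ᶠ N in atTop, X N ++ Y N ∈ L)
    (hX : RunThenBreak P d ρ (fun N => (X N).reverse)) (hY : RunThenBreak P d ρ Y) : False := by
  obtain ⟨z, p, s, w, r, hz, -, hYz, hrw, hr⟩ := hY
  obtain ⟨z', p', s', w', r', hz', -, hXz', hrw', hr'⟩ := hX
  have key : ∀ᶠ N in atTop, r'.reverse ++ (z' N).reverse ++ z N ++ r ∈ L ∧ p <+: z N := by
    filter_upwards [hXY, hYz, hrw, hXz', hrw', hz.eventually_run] with N h1 h2 h3 h4 h5 h6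
    refine ⟨hL _ h1 _ ?_, h6.1⟩
    have h4 : X N = (w' N).reverse ++ (z' N).reverse := by
      rw [← List.reverse_append, ← h4, List.reverse_reverse]
    rw [h4, h2]
    have := infix_append_of_suffix_of_prefix (m := (z' N).reverse ++ z N)
      (List.reverse_suffix.2 h5) h3
    simpa using this
  have hr'' : ¬ (r'.reverse ++ s'.reverse).HasPeriod P := by
    rwa [← List.reverse_append, hasPeriod_reverse]
  by_cases hj : (p'.reverse ++ [] ++ p).HasPeriod P
  · rcases hT _ _ _ r'.reverse r (hz'.reverse.append_run hz hj) (by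
      filter_upwards [key] with N h
      simpa using h.1) with h | h
    · exact hr'' h
    · exact hr h
  · rcases hT _ _ _ r'.reverse p hz'.reverse (by
      filter_upwards [key] with N h
      refine hL _ h.1 _ ?_
      have := infix_append_of_suffix_of_prefix (m := (z' N).reverse)
        (List.suffix_refl r'.reverse) (h.2.trans (List.prefix_append (z N) r))
      simpa using this) with h | h
    · exact hr'' h
    · exact hj (by simpa using h)

theorem fewCuts [Fintype B] (hP : 0 < P) (hL : FactorClosed L)
    (hT : NoBrokenRun P d L) (hXY : ∀ᶠ N in atTop, X N ++ Y N ∈ L)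
    (hX : PrefixStable ρ (fun N => (X N).reverse) ∨ RunThenBreak P d ρ (fun N => (X N).reverse))
    (hY : PrefixStable ρ Y ∨ RunThenBreak P d ρ Y) : FewCuts ρ X Y := by
  rcases hX with hX | hX
  · rcases hY with hY | hY
    · exact FewCuts.of_stable hX hY
    · exact FewCuts.of_stable_of_break hP hL hT hXY hX hY
  · rcases hY with hY | hY
    · refine FewCuts.of_reverse
        (FewCuts.of_stable_of_break hP hL.reverse hT.reverse ?_ (by simpa using hY) hX)
      filter_upwards [hXY] with N h
      simpa using h
    · exact (RunThenBreak.not_both hL hT hXY hX hY).elim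

end Cuts

section Iterates

variable {A : Type*} (φ : A → List A)

@[simp] theorem wordMap_nil : wordMap φ [] = [] := rfl

@[simp] theorem wordMap_append (x y : List A) :
    wordMap φ (x ++ y) = wordMap φ x ++ wordMap φ y := by simp [wordMap]

@[simp] theorem wordMap_singleton (b : A) : wordMap φ [b] = φ b := by simp [wordMap]

theorem wordMap_cons (b : A) (y : List A) : wordMap φ (b :: y) = φ b ++ wordMap φ y := rfl

@[simp] theorem iterate_wordMap_nil (N : ℕ) : (wordMap φ)^[N] [] = [] :=
  Function.iterate_fixed rfl N

@[simp] theorem iterate_wordMap_append (N : ℕ) (x y : List A) :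
    (wordMap φ)^[N] (x ++ y) = (wordMap φ)^[N] x ++ (wordMap φ)^[N] y := by
  induction N generalizing x y with
  | zero => rfl
  | succ N ih => simp [ih]

theorem iterate_wordMap_cons (N : ℕ) (b : A) (y : List A) :
    (wordMap φ)^[N] (b :: y) = (wordMap φ)^[N] [b] ++ (wordMap φ)^[N] y :=
  iterate_wordMap_append φ N [b] y

theorem iterate_succ_singleton (N : ℕ) (b : A) :
    (wordMap φ)^[N + 1] [b] = (wordMap φ)^[N] (φ b) := by simp

theorem iterate_wordMap_eq_nil_of_le {y : List A} {N M : ℕ} (h : (wordMap φ)^[N] y = [])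
    (hNM : N ≤ M) : (wordMap φ)^[M] y = [] := by
  obtain ⟨m, rfl⟩ := Nat.exists_eq_add_of_le' hNM
  rw [Function.iterate_add_apply, h, iterate_wordMap_nil]

theorem iterate_infix {x y : List A} (h : x <:+: y) (N : ℕ) :
    (wordMap φ)^[N] x <:+: (wordMap φ)^[N] y := by
  obtain ⟨s, t, rfl⟩ := h
  simp only [iterate_wordMap_append]
  exact ⟨_, _, rfl⟩

theorem mem_iterate_iff {N : ℕ} {y : List A} {c : A} :
    c ∈ (wordMap φ)^[N] y ↔ ∃ b ∈ y, c ∈ (wordMap φ)^[N] [b] := by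
  induction y with
  | nil => simp
  | cons b y ih => rw [iterate_wordMap_cons, List.mem_append, ih]; simp

/-- The morphism raised to the power `q`. -/
def powMorphism (q : ℕ) (b : A) : List A := (wordMap φ)^[q] [b]

theorem wordMap_powMorphism (q : ℕ) (y : List A) :
    wordMap (powMorphism φ q) y = (wordMap φ)^[q] y := by
  induction y with
  | nil => simp
  | cons b y ih => rw [wordMap_cons, ih, iterate_wordMap_cons, powMorphism]

theorem iterate_powMorphism (q N : ℕ) (y : List A) :
    (wordMap (powMorphism φ q))^[N] y = (wordMap φ)^[q * N] y := by
  rw [Function.iterate_mul, ← funext (wordMap_powMorphism φ q)]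

/-- The mirror image of a morphism. -/
def revMorphism (b : A) : List A := (φ b).reverse

theorem wordMap_revMorphism (y : List A) :
    wordMap (revMorphism φ) y = (wordMap φ y.reverse).reverse := by
  induction y with
  | nil => rfl
  | cons b y ih => rw [wordMap_cons, ih]; simp [revMorphism]

theorem iterate_revMorphism (N : ℕ) (y : List A) :
    (wordMap (revMorphism φ))^[N] y = ((wordMap φ)^[N] y.reverse).reverse := by
  induction N generalizing y with
  | zero => simp
  | succ N ih => simp [ih, wordMap_revMorphism]

theorem revMorphism_revMorphism : revMorphism (revMorphism φ) = φ := by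
  ext1 b; simp [revMorphism]

end Iterates

section Levels

variable {A : Type*}

open Classical in
/-- The number of letters of `y` which do not belong to `E`. -/
noncomputable def outCount (E : Set A) (y : List A) : ℕ := y.countP (fun b => decide (b ∉ E))

@[simp] theorem outCount_nil (E : Set A) : outCount E [] = 0 := by simp [outCount]

@[simp] theorem outCount_append (E : Set A) (x y : List A) :
    outCount E (x ++ y) = outCount E x + outCount E y := by simp [outCount]

theorem outCount_cons (E : Set A) (b : A) (y : List A) :
    outCount E (b :: y) = outCount E [b] + outCount E y := outCount_append E [b] y

theorem outCount_singleton_of_notMem {E : Set A} {b : A} (h : b ∉ E) : outCount E [b] = 1 := by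
  simp [outCount, h]

theorem outCount_eq_zero {E : Set A} {y : List A} : outCount E y = 0 ↔ ∀ c ∈ y, c ∈ E := by
  simp [outCount]

theorem outCount_pos {E : Set A} {y : List A} {c : A} (hc : c ∈ y) (h : c ∉ E) :
    0 < outCount E y := by
  rw [Nat.pos_iff_ne_zero, Ne, outCount_eq_zero]
  exact fun h' => h (h' c hc)

theorem outCount_le_length (E : Set A) (y : List A) : outCount E y ≤ y.length :=
  List.countP_le_length

@[simp] theorem outCount_reverse (E : Set A) (y : List A) :
    outCount E y.reverse = outCount E y := by simp [outCount]

/-- The letters whose iterates grow at most like a polynomial: level `0` consists of the mortal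
letters, and the iterates of a letter of level `j + 1` contain boundedly many letters which are
not of level `j`. -/
def level (φ : A → List A) : ℕ → Set A
  | 0 => {b | ∃ N, (wordMap φ)^[N] [b] = []}
  | j + 1 => {b | ∃ C, ∀ N, outCount (level φ j) ((wordMap φ)^[N] [b]) ≤ C}

variable {φ : A → List A}

theorem forall_mem_level_zero {y : List A} :
    (∀ c ∈ y, c ∈ level φ 0) ↔ ∃ N, (wordMap φ)^[N] y = [] := by
  induction y with
  | nil => simp
  | cons b y ih =>
    rw [List.forall_mem_cons, ih]
    constructor
    · rintro ⟨⟨N, hN⟩, M, hM⟩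
      refine ⟨max N M, ?_⟩
      rw [iterate_wordMap_cons, iterate_wordMap_eq_nil_of_le φ hN (le_max_left _ _),
        iterate_wordMap_eq_nil_of_le φ hM (le_max_right _ _)]
      rfl
    · rintro ⟨N, hN⟩
      rw [iterate_wordMap_cons, List.append_eq_nil_iff] at hN
      exact ⟨⟨N, hN.1⟩, N, hN.2⟩

theorem forall_mem_level_succ {j : ℕ} {y : List A} :
    (∀ c ∈ y, c ∈ level φ (j + 1)) ↔ ∃ C, ∀ N, outCount (level φ j) ((wordMap φ)^[N] y) ≤ C := by
  induction y with
  | nil => simp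
  | cons b y ih =>
    rw [List.forall_mem_cons, ih]
    constructor
    · rintro ⟨⟨C, hC⟩, D, hD⟩
      refine ⟨C + D, fun N => ?_⟩
      rw [iterate_wordMap_cons, outCount_append]
      exact add_le_add (hC N) (hD N)
    · rintro ⟨C, hC⟩
      have : ∀ N, outCount (level φ j) ((wordMap φ)^[N] [b]) +
          outCount (level φ j) ((wordMap φ)^[N] y) ≤ C := by
        intro N
        rw [← outCount_append, ← iterate_wordMap_cons]
        exact hC N
      exact ⟨⟨C, fun N => by have := this N; omega⟩, C, fun N => by have := this N; omega⟩

/-- A letter and its image have the same level. -/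
theorem mem_level_iff {j : ℕ} {b : A} : b ∈ level φ j ↔ ∀ c ∈ φ b, c ∈ level φ j := by
  cases j with
  | zero =>
    rw [forall_mem_level_zero]
    constructor
    · rintro ⟨N, hN⟩
      refine ⟨N, ?_⟩
      rw [← iterate_succ_singleton]
      exact iterate_wordMap_eq_nil_of_le φ hN (Nat.le_succ N)
    · rintro ⟨N, hN⟩
      exact ⟨N + 1, by rwa [iterate_succ_singleton]⟩
  | succ j =>
    rw [forall_mem_level_succ]
    constructor
    · rintro ⟨C, hC⟩
      exact ⟨C, fun N => by rw [← iterate_succ_singleton]; exact hC _⟩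
    · rintro ⟨C, hC⟩
      refine ⟨C + 1, fun N => ?_⟩
      cases N with
      | zero => exact (outCount_le_length _ _).trans (by simp)
      | succ N => rw [iterate_succ_singleton]; exact (hC N).trans (Nat.le_succ C)

theorem forall_mem_level_wordMap {j : ℕ} {y : List A} :
    (∀ c ∈ wordMap φ y, c ∈ level φ j) ↔ ∀ c ∈ y, c ∈ level φ j := by
  simp only [wordMap, List.mem_flatMap]
  exact ⟨fun h c hc => mem_level_iff.2 fun b hb => h b ⟨c, hc, hb⟩,
    fun h b ⟨c, hc, hb⟩ => mem_level_iff.1 (h c hc) b hb⟩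

theorem forall_mem_level_iterate {j N : ℕ} {y : List A} :
    (∀ c ∈ (wordMap φ)^[N] y, c ∈ level φ j) ↔ ∀ c ∈ y, c ∈ level φ j := by
  induction N generalizing y with
  | zero => rfl
  | succ N ih => rw [Function.iterate_succ_apply, ih, forall_mem_level_wordMap]

theorem level_le_succ (j : ℕ) : level φ j ⊆ level φ (j + 1) := by
  intro b hb
  refine ⟨0, fun N => ?_⟩
  rw [Nat.le_zero, outCount_eq_zero, forall_mem_level_iterate]
  simpa using hb

theorem level_mono {i j : ℕ} (h : i ≤ j) : level φ i ⊆ level φ j :=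
  monotone_nat_of_le_succ (f := level φ) level_le_succ h

theorem outCount_le_image {j : ℕ} (b : A) :
    outCount (level φ j) [b] ≤ outCount (level φ j) (φ b) := by
  by_cases hb : b ∈ level φ j
  · rw [outCount_eq_zero.2 (by simpa using hb)]
    exact Nat.zero_le _
  · rw [outCount_singleton_of_notMem hb]
    rw [mem_level_iff] at hb
    push Not at hb
    obtain ⟨c, hc, hc'⟩ := hb
    exact outCount_pos hc hc'

theorem outCount_le_wordMap {j : ℕ} (y : List A) :
    outCount (level φ j) y ≤ outCount (level φ j) (wordMap φ y) := by
  induction y with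
  | nil => simp
  | cons b y ih =>
    rw [outCount_cons, wordMap_cons, outCount_append]
    exact add_le_add (outCount_le_image b) ih

theorem outCount_monotone (j : ℕ) (y : List A) :
    Monotone fun N => outCount (level φ j) ((wordMap φ)^[N] y) :=
  monotone_nat_of_le_succ fun N => by
    rw [Function.iterate_succ_apply']
    exact outCount_le_wordMap _

theorem outCount_image_eq_one {j : ℕ} {y : List A}
    (h : outCount (level φ j) (wordMap φ y) = outCount (level φ j) y) {e : A} (he : e ∈ y)
    (hej : e ∉ level φ j) : outCount (level φ j) (φ e) = 1 := by
  induction y with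
  | nil => simp at he
  | cons b y ih =>
    have h1 := outCount_le_image (φ := φ) (j := j) b
    have h2 := outCount_le_wordMap (φ := φ) (j := j) y
    rw [outCount_cons, wordMap_cons, outCount_append] at h
    rcases List.mem_cons.1 he with rfl | he
    · rw [outCount_singleton_of_notMem hej] at h h1
      omega
    · exact ih (by omega) he

theorem exists_first_out {E : Set A} {y : List A} (h : ¬ ∀ c ∈ y, c ∈ E) :
    ∃ u e v, y = u ++ e :: v ∧ (∀ c ∈ u, c ∈ E) ∧ e ∉ E := by
  induction y with
  | nil => simp at h
  | cons b y ih =>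
    by_cases hb : b ∈ E
    · obtain ⟨u, e, v, rfl, hu, he⟩ := ih (by simpa [hb] using h)
      exact ⟨b :: u, e, v, rfl, by simpa [hb] using hu, he⟩
    · exact ⟨[], b, y, rfl, by simp, hb⟩

theorem first_out_unique {E : Set A} {u u' v v' : List A} {e e' : A}
    (h : u ++ e :: v = u' ++ e' :: v') (hu : ∀ c ∈ u, c ∈ E) (hu' : ∀ c ∈ u', c ∈ E)
    (he : e ∉ E) (he' : e' ∉ E) : e = e' := by
  induction u generalizing u' with
  | nil =>
    cases u' with
    | nil => simp at h; exact h.1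
    | cons b u' => simp at h; exact absurd (hu' b (by simp)) (h.1 ▸ he)
  | cons b u ih =>
    cases u' with
    | nil => simp at h; exact absurd (hu b (by simp)) (h.1 ▸ he')
    | cons b' u' =>
      simp only [List.cons_append, List.cons.injEq] at h
      exact ih h.2 (fun c hc => hu c (by simp [hc])) (fun c hc => hu' c (by simp [hc]))

/-- The first letter of `φ e` which is not of level `j` is itself mapped to a word in which it is
the first letter not of level `j`. -/
def FirstIdempotent (φ : A → List A) : Prop :=
  ∀ j e u e' v, φ e = u ++ e' :: v → (∀ c ∈ u, c ∈ level φ j) → e' ∉ level φ j →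
    ∃ u' v', φ e' = u' ++ e' :: v' ∧ ∀ c ∈ u', c ∈ level φ j

/-- After finitely many steps the iterates of a letter of level `j + 1` contain only letters of
level `j` and letters which reproduce themselves between letters of level `j`. -/
theorem exists_iterate_idempotent (hφ : FirstIdempotent φ) {j : ℕ} {y : List A}
    (hy : ∀ c ∈ y, c ∈ level φ (j + 1)) :
    ∃ N, ∀ e ∈ (wordMap φ)^[N] y, e ∉ level φ j →
      ∃ l r, φ e = l ++ [e] ++ r ∧ (∀ c ∈ l, c ∈ level φ j) ∧ ∀ c ∈ r, c ∈ level φ j := by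
  obtain ⟨C, hC⟩ := forall_mem_level_succ.1 hy
  have hmono := outCount_monotone (φ := φ) j y
  obtain ⟨N, hN⟩ : ∃ N, ∀ M, N ≤ M → outCount (level φ j) ((wordMap φ)^[M] y) =
      outCount (level φ j) ((wordMap φ)^[N] y) := by
    have hb : BddAbove (Set.range fun N => outCount (level φ j) ((wordMap φ)^[N] y)) :=
      ⟨C, by rintro _ ⟨N, rfl⟩; exact hC N⟩
    obtain ⟨N, hN⟩ := Nat.sSup_mem (Set.range_nonempty _) hb
    refine ⟨N, fun M hM => le_antisymm ?_ (hmono hM)⟩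
    refine (le_csSup hb ⟨M, rfl⟩).trans hN.ge
  have hone : ∀ M, N ≤ M → ∀ e ∈ (wordMap φ)^[M] y, e ∉ level φ j →
      outCount (level φ j) (φ e) = 1 := by
    intro M hM e he hej
    refine outCount_image_eq_one ?_ he hej
    rw [← Function.iterate_succ_apply' (wordMap φ), hN M hM, hN (M + 1) (by omega)]
  refine ⟨N + 1, fun e he hej => ?_⟩
  have h1 := hone (N + 1) (by omega) e he hej
  rw [Function.iterate_succ_apply', wordMap, List.mem_flatMap] at he
  obtain ⟨b, hb, heb⟩ := he
  have hbj : b ∉ level φ j := fun h => hej (mem_level_iff.1 h e heb)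
  have h2 := hone N le_rfl b hb hbj
  obtain ⟨s, t, hst⟩ := List.append_of_mem heb
  have hs : outCount (level φ j) s = 0 := by
    rw [hst, outCount_append, outCount_cons, outCount_singleton_of_notMem hej] at h2
    omega
  obtain ⟨u, v, huv, hu⟩ := hφ j b s e t hst (outCount_eq_zero.1 hs) hej
  refine ⟨u, v, by simpa using huv, hu, ?_⟩
  rw [huv, outCount_append, outCount_cons, outCount_singleton_of_notMem hej] at h1
  exact outCount_eq_zero.1 (by omega)

theorem level_powMorphism {q : ℕ} (hq : 0 < q) (j : ℕ) :
    level (powMorphism φ q) j = level φ j := by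
  induction j with
  | zero =>
    ext b
    simp only [level, iterate_powMorphism, Set.mem_ofPred_eq]
    exact ⟨fun ⟨N, h⟩ => ⟨_, h⟩, fun ⟨N, h⟩ =>
      ⟨N, iterate_wordMap_eq_nil_of_le φ h (Nat.le_mul_of_pos_left N hq)⟩⟩
  | succ j ih =>
    ext b
    simp only [level, iterate_powMorphism, Set.mem_ofPred_eq, ih]
    exact ⟨fun ⟨C, h⟩ => ⟨C, fun N =>
      (outCount_monotone j [b] (Nat.le_mul_of_pos_left N hq)).trans (h N)⟩,
      fun ⟨C, h⟩ => ⟨C, fun N => h _⟩⟩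

theorem level_revMorphism (j : ℕ) : level (revMorphism φ) j = level φ j := by
  induction j with
  | zero => ext b; simp [level, iterate_revMorphism]
  | succ j ih => ext b; simp [level, iterate_revMorphism, ih]

theorem exists_forall_iterate_idempotent (A : Type*) [Finite A] :
    ∃ q, 0 < q ∧ ∀ (f : A → A) (x : A), f^[q] (f^[q] x) = f^[q] x := by
  classical
  have := Fintype.ofFinite A
  refine ⟨(Fintype.card (A → A)).factorial, Nat.factorial_pos _, fun f x => ?_⟩
  set K := Fintype.card (A → A)
  obtain ⟨m, n, hmn, h⟩ := Fintype.exists_ne_map_eq_of_card_lt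
    (fun i : Fin (K + 1) => f^[(i : ℕ)]) (by simp [K])
  wlog hlt : m < n generalizing m n
  · exact this n m hmn.symm h.symm (lt_of_le_of_ne (not_lt.1 hlt) hmn.symm)
  have hlt' : (m : ℕ) < n := hlt
  obtain ⟨c, hc⟩ := Nat.dvd_factorial (m := (n : ℕ) - m) (n := K) (by omega) (by omega)
  have hstep : ∀ t, (m : ℕ) ≤ t → f^[t + (n - m)] = f^[t] := by
    intro t ht
    obtain ⟨i, rfl⟩ := Nat.exists_eq_add_of_le' ht
    have h : f^[(m : ℕ)] = f^[(n : ℕ)] := h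
    rw [show i + m + (n - m) = i + n by omega, Function.iterate_add, Function.iterate_add, h]
  have hmul : ∀ i t, (m : ℕ) ≤ t → f^[t + (n - m) * i] = f^[t] := by
    intro i
    induction i with
    | zero => simp
    | succ i ih =>
      intro t ht
      rw [Nat.mul_succ, ← add_assoc, hstep _ (by omega), ih t ht]
  rw [← Function.iterate_add_apply]
  conv_lhs => rw [show K.factorial + K.factorial = K.factorial + (n - m) * c by omega]
  rw [hmul c _ (by have := Nat.self_le_factorial K; omega)]

theorem exists_firstIdempotent_pow (φ : A → List A) {q : ℕ}  (hq : 0 < q)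
    (hidem : ∀ (f : A → A) (x : A), f^[q] (f^[q] x) = f^[q] x) :
    FirstIdempotent (powMorphism φ q) := by
  intro j e u e' v he hu he'
  rw [level_powMorphism hq] at hu he' ⊢
  have hex : ∀ b, ∃ c, b ∉ level φ j → ∃ s t, φ b = s ++ c :: t ∧ (∀ a ∈ s, a ∈ level φ j) ∧
      c ∉ level φ j := by
    intro b
    by_cases hb : b ∈ level φ j
    · exact ⟨b, fun h => absurd hb h⟩
    · rw [mem_level_iff] at hb
      obtain ⟨s, c, t, h⟩ := exists_first_out hb
      exact ⟨c, fun _ => ⟨s, t, h⟩⟩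
  choose f hf using hex
  have hiter : ∀ N, ∀ b, b ∉ level φ j → f^[N] b ∉ level φ j ∧
      ∃ s t, (wordMap φ)^[N] [b] = s ++ f^[N] b :: t ∧ ∀ a ∈ s, a ∈ level φ j := by
    intro N b hb
    induction N with
    | zero => exact ⟨hb, [], [], by simp⟩
    | succ N ih =>
      obtain ⟨h1, s, t, h2, h3⟩ := ih
      obtain ⟨s', t', h4, h5, h6⟩ := hf _ h1
      rw [Function.iterate_succ_apply', Function.iterate_succ_apply', h2]
      refine ⟨h6, wordMap φ s ++ s', t' ++ wordMap φ t, by simp [wordMap_cons, h4], ?_⟩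
      intro a ha
      rcases List.mem_append.1 ha with ha | ha
      · exact forall_mem_level_wordMap.2 h3 a ha
      · exact h5 a ha
  have hej : e ∉ level φ j := by
    intro h
    refine he' (forall_mem_level_iterate (φ := φ) (N := q) (y := [e]).2 (by simpa) e' ?_)
    change e' ∈ powMorphism φ q e
    simp [he]
  obtain ⟨h1, s, t, h2, h3⟩ := hiter q e hej
  have h4 : e' = f^[q] e := first_out_unique (E := level φ j)
    (he.symm.trans h2) hu h3 he' h1
  obtain ⟨-, s', t', h5, h6⟩ := hiter q e' he'
  refine ⟨s', t', ?_, h6⟩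
  rw [h4, hidem, ← h4] at h5
  exact h5

theorem powMorphism_revMorphism (φ : A → List A) (q : ℕ) :
    powMorphism (revMorphism φ) q = revMorphism (powMorphism φ q) := by
  ext1 b
  simp [powMorphism, iterate_revMorphism, revMorphism]

theorem exists_level_eq_succ [Finite A] (φ : A → List A) : ∃ k, level φ k = level φ (k + 1) := by
  obtain ⟨n, hn⟩ := WellFoundedGT.monotone_chain_condition
    (⟨level φ, fun _ _ h => level_mono h⟩ : ℕ →o Set A)
  exact ⟨n, hn (n + 1) (Nat.le_succ n)⟩

end Levels

section Growth

variable {A : Type*} {φ : A → List A}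

theorem length_iterate_pos {j : ℕ} {b : A} (hb : b ∉ level φ j) (N : ℕ) :
    0 < ((wordMap φ)^[N] [b]).length := by
  rw [List.length_pos_iff]
  intro h
  exact hb (level_mono (Nat.zero_le j) ⟨N, h⟩)

theorem length_iterate_le_of_mem {b : A} {y : List A} (hb : b ∈ y) (N : ℕ) :
    ((wordMap φ)^[N] [b]).length ≤ ((wordMap φ)^[N] y).length := by
  obtain ⟨s, t, rfl⟩ := List.append_of_mem hb
  refine (iterate_infix φ ⟨s, t, ?_⟩ N).length_le
  simp

theorem exists_two_le_outCount [Finite A] (φ : A → List A) (j : ℕ) :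
    ∃ M, 0 < M ∧ ∀ c ∉ level φ (j + 1), 2 ≤ outCount (level φ j) ((wordMap φ)^[M] [c]) := by
  have : ∀ c, ∃ M, c ∉ level φ (j + 1) → 2 ≤ outCount (level φ j) ((wordMap φ)^[M] [c]) := by
    intro c
    by_cases hc : c ∈ level φ (j + 1)
    · exact ⟨0, fun h => absurd hc h⟩
    · simp only [level, Set.mem_ofPred_eq, not_exists, not_forall, not_le] at hc
      obtain ⟨M, hM⟩ := hc 1
      exact ⟨M, fun _ => hM⟩
  choose M hM using this
  obtain ⟨K, hK⟩ := Set.Finite.bddAbove (Set.finite_range M)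
  refine ⟨K + 1, Nat.succ_pos K, fun c hc => (hM c hc).trans (outCount_monotone j [c] ?_)⟩
  exact (hK ⟨c, rfl⟩).trans (Nat.le_succ K)

theorem outCount_iterate_mul {j M : ℕ}
    (hM : ∀ c ∉ level φ (j + 1), 2 ≤ outCount (level φ j) ((wordMap φ)^[M] [c])) (i : ℕ) (c : A)
    (hc : c ∉ level φ (j + 1)) :
    i + 1 ≤ outCount (level φ j) ((wordMap φ)^[M * i] [c]) := by
  induction i generalizing c with
  | zero =>
    simp [outCount_singleton_of_notMem fun h => hc (level_le_succ j h)]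
  | succ i ih =>
    have h1 : ¬ ∀ b ∈ (wordMap φ)^[M] [c], b ∈ level φ (j + 1) := by
      rw [forall_mem_level_iterate]
      simpa using hc
    obtain ⟨u, e, v, h2, -, he⟩ := exists_first_out h1
    have h3 := hM c hc
    have h4 := ih e he
    have h5 := outCount_monotone (φ := φ) j u (Nat.zero_le (M * i))
    have h6 := outCount_monotone (φ := φ) j v (Nat.zero_le (M * i))
    rw [Nat.mul_succ, Function.iterate_add_apply, h2, iterate_wordMap_append,
      iterate_wordMap_cons]
    rw [h2, outCount_append, outCount_cons,
      outCount_singleton_of_notMem fun h => he (level_le_succ j h)] at h3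
    simp only [outCount_append, Function.iterate_zero, id] at *
    omega

theorem two_pow_le_outCount {j M : ℕ} (hj : level φ j = level φ (j + 1))
    (hM : ∀ c ∉ level φ (j + 1), 2 ≤ outCount (level φ j) ((wordMap φ)^[M] [c])) (i : ℕ)
    (y : List A) : 2 ^ i * outCount (level φ j) y ≤
      outCount (level φ j) ((wordMap φ)^[M * i] y) := by
  have base : ∀ y, 2 * outCount (level φ j) y ≤ outCount (level φ j) ((wordMap φ)^[M] y) := by
    intro y
    induction y with
    | nil => simp
    | cons b y ih =>
      rw [outCount_cons, iterate_wordMap_cons, outCount_append, mul_add]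
      refine add_le_add ?_ ih
      by_cases hb : b ∈ level φ j
      · rw [outCount_eq_zero.2 (by simpa using hb)]; simp
      · rw [outCount_singleton_of_notMem hb]
        exact hM b (hj ▸ hb)
  induction i with
  | zero => simp
  | succ i ih =>
    rw [Nat.mul_succ, add_comm (M * i) M, Function.iterate_add_apply]
    refine le_trans ?_ (base _)
    rw [pow_succ, mul_comm _ 2, mul_assoc]
    exact Nat.mul_le_mul le_rfl ih

theorem outCount_mul_le_length {E : Set A} {N m : ℕ}
    (h : ∀ c ∉ E, m ≤ ((wordMap φ)^[N] [c]).length) (y : List A) :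
    outCount E y * m ≤ ((wordMap φ)^[N] y).length := by
  induction y with
  | nil => simp
  | cons b y ih =>
    rw [outCount_cons, iterate_wordMap_cons, List.length_append, add_mul]
    refine add_le_add ?_ ih
    by_cases hb : b ∈ E
    · rw [outCount_eq_zero.2 (by simpa using hb)]; simp
    · rw [outCount_singleton_of_notMem hb, one_mul]
      exact h b hb

/-- Iterates of letters which are not of level `k` grow at least like `N ^ k`. -/
theorem exists_pow_le_length [Finite A] (φ : A → List A) (k : ℕ) :
    ∃ M, 0 < M ∧ ∀ b ∉ level φ k, ∀ N, N ^ k ≤ M * ((wordMap φ)^[N] [b]).length := by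
  induction k with
  | zero =>
    exact ⟨1, one_pos, fun b hb N => by
      have := length_iterate_pos hb N
      rw [pow_zero]
      omega⟩
  | succ k ih =>
    obtain ⟨M₁, hM₁, h₁⟩ := ih
    obtain ⟨M₂, hM₂, h₂⟩ := exists_two_le_outCount φ k
    refine ⟨2 ^ (k + 1) * (M₂ * M₁), by positivity, fun b hb N => ?_⟩
    have hN : N = (N - N / 2) + N / 2 := by omega
    set a := N / 2
    set c := N - N / 2
    have h3 : a + 1 ≤ M₂ * outCount (level φ k) ((wordMap φ)^[a] [b]) := by
      have h4 := outCount_iterate_mul h₂ (a / M₂) b hb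
      have h5 := outCount_monotone (φ := φ) k [b] (Nat.mul_div_le a M₂)
      have h6 := Nat.lt_mul_div_succ a hM₂
      calc a + 1 ≤ M₂ * (a / M₂ + 1) := h6
        _ ≤ _ := Nat.mul_le_mul le_rfl (h4.trans h5)
    have h7 : ∀ e ∉ level φ k, (c ^ k + M₁ - 1) / M₁ ≤ ((wordMap φ)^[c] [e]).length := by
      intro e he
      have := h₁ e he c
      rw [← Nat.lt_succ_iff, Nat.div_lt_iff_lt_mul hM₁]
      rw [Nat.succ_mul, mul_comm]
      omega
    have h8 := outCount_mul_le_length h7 ((wordMap φ)^[a] [b])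
    rw [← Function.iterate_add_apply, ← hN] at h8
    have h9 : c ^ k ≤ M₁ * ((c ^ k + M₁ - 1) / M₁) := by
      have := Nat.lt_mul_div_succ (c ^ k + M₁ - 1) hM₁
      rw [Nat.mul_succ] at this
      omega
    set m := (c ^ k + M₁ - 1) / M₁
    set o := outCount (level φ k) ((wordMap φ)^[a] [b])
    calc N ^ (k + 1) = N ^ k * N := pow_succ N k
      _ ≤ (2 * c) ^ k * (2 * (a + 1)) :=
        Nat.mul_le_mul (Nat.pow_le_pow_left (by omega) k) (by omega)
      _ = 2 ^ (k + 1) * ((a + 1) * c ^ k) := by rw [mul_pow]; ring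
      _ ≤ 2 ^ (k + 1) * ((M₂ * o) * (M₁ * m)) :=
        Nat.mul_le_mul le_rfl (Nat.mul_le_mul h3 h9)
      _ = 2 ^ (k + 1) * (M₂ * M₁) * (o * m) := by ring
      _ ≤ _ := Nat.mul_le_mul le_rfl h8

theorem exists_two_pow_le_length [Finite A] {φ : A → List A} {k : ℕ}
    (hk : level φ k = level φ (k + 1)) :
    ∃ M, 0 < M ∧ ∀ b ∉ level φ k, ∀ N, 2 ^ (N / M) ≤ ((wordMap φ)^[N] [b]).length := by
  obtain ⟨M, hM, h⟩ := exists_two_le_outCount φ k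
  refine ⟨M, hM, fun b hb N => ?_⟩
  have h1 := two_pow_le_outCount hk h (N / M) [b]
  rw [outCount_singleton_of_notMem hb, mul_one] at h1
  have h2 := outCount_monotone (φ := φ) k [b] (Nat.mul_div_le N M)
  exact (h1.trans h2).trans (outCount_le_length _ _)

end Growth

section Systems

variable {A B : Type*} {P k : ℕ}

/-- A morphism `φ`, a coding `ψ`, a set `I` of words stable under `φ` and a set `L` containing
their images under `ψ`, together with a period `P` and the idempotency conditions of
`FirstIdempotent`. -/
structure MorphicSystem (φ : A → List A) (ψ : A → B) (P : ℕ) (I : Set (List A))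
    (L : Set (List B)) : Prop where
  pos : 0 < P
  closed : FactorClosed L
  closed' : FactorClosed I
  wordMap_mem : ∀ y ∈ I, wordMap φ y ∈ I
  map_mem : ∀ y ∈ I, y.map ψ ∈ L
  first : FirstIdempotent φ
  last : FirstIdempotent (revMorphism φ)
  dvd : ∀ c u m, u <:+: φ c → 0 < m → (∀ᶠ N in atTop, ((wordMap φ)^[N] u).length = m) → m ∣ P

variable {φ : A → List A} {ψ : A → B} {I : Set (List A)} {L : Set (List B)}

theorem MorphicSystem.reverse (h : MorphicSystem φ ψ P I L) :
    MorphicSystem (revMorphism φ) ψ P (List.reverse ⁻¹' I) (List.reverse ⁻¹' L) where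
  pos := h.pos
  closed := h.closed.reverse
  closed' := h.closed'.reverse
  wordMap_mem y hy := by
    simpa [wordMap_revMorphism] using h.wordMap_mem _ hy
  map_mem y hy := by simpa using h.map_mem _ hy
  first := h.last
  last := by rw [revMorphism_revMorphism]; exact h.first
  dvd c u m hu hm hN := by
    refine h.dvd c u.reverse m ?_ hm ?_
    · rw [revMorphism] at hu
      simpa using List.reverse_infix.2 hu
    · simpa [iterate_revMorphism] using hN

theorem MorphicSystem.iterate_mem (h : MorphicSystem φ ψ P I L) {y : List A} (hy : y ∈ I) (N : ℕ) :
    (wordMap φ)^[N] y ∈ I := by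
  induction N with
  | zero => exact hy
  | succ N ih => rw [Function.iterate_succ_apply']; exact h.wordMap_mem _ ih

/-- The word `φ^(N-1)(l) ⋯ φ(l) l`. -/
def leftSum (φ : A → List A) (l : List A) : ℕ → List A
  | 0 => []
  | N + 1 => (wordMap φ)^[N] l ++ leftSum φ l N

/-- The word `r φ(r) ⋯ φ^(N-1)(r)`. -/
def rightSum (φ : A → List A) (r : List A) : ℕ → List A
  | 0 => []
  | N + 1 => rightSum φ r N ++ (wordMap φ)^[N] r

theorem iterate_eq_sums {e : A} {l r : List A} (he : φ e = l ++ [e] ++ r) (N : ℕ) :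
    (wordMap φ)^[N] [e] = leftSum φ l N ++ [e] ++ rightSum φ r N := by
  induction N with
  | zero => simp [leftSum, rightSum]
  | succ N ih =>
    rw [iterate_succ_singleton, he, iterate_wordMap_append, iterate_wordMap_append, ih]
    simp [leftSum, rightSum]

theorem length_leftSum (l : List A) (N : ℕ) :
    (leftSum φ l N).length = ∑ i ∈ Finset.range N, ((wordMap φ)^[i] l).length := by
  induction N with
  | zero => simp [leftSum]
  | succ N ih => rw [Finset.sum_range_succ, ← ih]; simp [leftSum, add_comm]

theorem length_rightSum (r : List A) (N : ℕ) :
    (rightSum φ r N).length = ∑ i ∈ Finset.range N, ((wordMap φ)^[i] r).length := by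
  induction N with
  | zero => simp [rightSum]
  | succ N ih => rw [Finset.sum_range_succ, ← ih]; simp [rightSum]

theorem leftSum_revMorphism (r : List A) (N : ℕ) :
    leftSum (revMorphism φ) r.reverse N = (rightSum φ r N).reverse := by
  induction N with
  | zero => rfl
  | succ N ih => simp [leftSum, rightSum, ih, iterate_revMorphism]

/-- Every word of `I` over letters of level `k + 1` generates a simple family. -/
def SimpleUpTo (φ : A → List A) (ψ : A → B) (P : ℕ) (I : Set (List A)) : ℕ → Prop
  | 0 => True
  | k + 1 => ∀ y ∈ I, (∀ c ∈ y, c ∈ level φ (k + 1)) →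
      Simple P k (fun N => ((wordMap φ)^[N] y).map ψ)

theorem SimpleUpTo.reverse (h : SimpleUpTo φ ψ P I k) :
    SimpleUpTo (revMorphism φ) ψ P (List.reverse ⁻¹' I) k := by
  cases k with
  | zero => trivial
  | succ k =>
    intro y hy hyk
    rw [level_revMorphism] at hyk
    simpa [iterate_revMorphism] using (h y.reverse hy (by simpa using hyk)).reverse

/-- A sum of iterates of letters of level `k` is a run of degree `k` up to a constant. -/
theorem MorphicSystem.leftSum_run (h : MorphicSystem φ ψ P I L)
    (hT : ∀ j, j < k → NoBrokenRun P j L) (hS : SimpleUpTo φ ψ P I k) {e : A} {l r : List A}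
    (heI : [e] ∈ I) (he : φ e = l ++ [e] ++ r) (hl : ∀ c ∈ l, c ∈ level φ k) :
    ∃ c Z p s, OptRun P k Z p s ∧ ∀ᶠ N in atTop, (leftSum φ l N).map ψ = Z N ++ c := by
  have hlφ : l <:+: φ e := ⟨[], [e] ++ r, by simp [he]⟩
  have hlI : l ∈ I := h.closed' _ (by simpa using h.wordMap_mem _ heI) _ hlφ
  cases k with
  | zero =>
    obtain ⟨N₀, hN₀⟩ := forall_mem_level_zero.1 hl
    refine ⟨(leftSum φ l N₀).map ψ, fun _ => [], [], [], Or.inr (by simp), ?_⟩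
    filter_upwards [eventually_ge_atTop N₀] with N hN
    induction N, hN using Nat.le_induction with
    | base => simp
    | succ N hN ih =>
      rw [leftSum, iterate_wordMap_eq_nil_of_le φ hN₀ hN, List.nil_append, ih]
  | succ k =>
    refine Simple.sum_left h.pos h.closed (hT k (Nat.lt_succ_self k)) (hS l hlI hl) ?_ ?_
      (fun N => by simp [leftSum])
    · refine Eventually.of_forall fun N => ?_
      have h1 := h.map_mem _ (h.iterate_mem heI (N + 4))
      rw [iterate_eq_sums he] at h1
      refine h.closed _ h1 _ ?_
      refine ⟨[], (leftSum φ l N ++ [e] ++ rightSum φ r (N + 4)).map ψ, ?_⟩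
      simp only [leftSum, List.map_append, List.nil_append, List.append_assoc]
    · intro u hu hN
      refine h.dvd e l u.length hlφ (List.length_pos_iff.2 hu) ?_
      filter_upwards [hN] with N hN
      rw [← hN, List.length_map]

theorem MorphicSystem.rightSum_run (h : MorphicSystem φ ψ P I L)
    (hT : ∀ j, j < k → NoBrokenRun P j L) (hS : SimpleUpTo φ ψ P I k) {e : A} {l r : List A}
    (heI : [e] ∈ I) (he : φ e = l ++ [e] ++ r) (hr : ∀ c ∈ r, c ∈ level φ k) :
    ∃ c Z p s, OptRun P k Z p s ∧ ∀ᶠ N in atTop, (rightSum φ r N).map ψ = c ++ Z N := by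
  obtain ⟨c, Z, p, s, hZ, hN⟩ := h.reverse.leftSum_run (fun j hj => (hT j hj).reverse)
    hS.reverse (e := e) (l := r.reverse) (r := l.reverse) (by simpa using heI)
    (by simp [revMorphism, he]) (by simpa [level_revMorphism] using hr)
  refine ⟨c.reverse, _, _, _, hZ.reverse, ?_⟩
  filter_upwards [hN] with N hN
  rw [leftSum_revMorphism] at hN
  rw [← List.reverse_append, ← hN]
  simp

theorem MorphicSystem.simple_of_idempotent (h : MorphicSystem φ ψ P I L)
    (hT : ∀ j, j < k → NoBrokenRun P j L) (hS : SimpleUpTo φ ψ P I k) {e : A} {l r : List A}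
    (heI : [e] ∈ I) (he : φ e = l ++ [e] ++ r) (hl : ∀ c ∈ l, c ∈ level φ k)
    (hr : ∀ c ∈ r, c ∈ level φ k) : Simple P k (fun N => ((wordMap φ)^[N] [e]).map ψ) := by
  obtain ⟨c, Z, p, s, hZ, hN⟩ := h.leftSum_run hT hS heI he hl
  obtain ⟨c', Z', p', s', hZ', hN'⟩ := h.rightSum_run hT hS heI he hr
  refine ⟨Z, Z', p, s, p', s', c ++ [ψ e] ++ c', hZ, hZ', ?_⟩
  filter_upwards [hN, hN'] with N h1 h2
  rw [iterate_eq_sums he]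
  simp [h1, h2]

theorem SimpleUpTo.simple (hS : SimpleUpTo φ ψ P I k) {y : List A} (hy : y ∈ I)
    (hyk : ∀ c ∈ y, c ∈ level φ k) : Simple P k (fun N => ((wordMap φ)^[N] y).map ψ) := by
  cases k with
  | zero =>
    obtain ⟨N₀, hN₀⟩ := forall_mem_level_zero.1 hyk
    refine Simple.const [] ?_
    filter_upwards [eventually_ge_atTop N₀] with N hN
    rw [iterate_wordMap_eq_nil_of_le φ hN₀ hN, List.map_nil]
  | succ k => exact (hS y hy hyk).mono (Nat.le_succ k)

theorem MorphicSystem.simple_of_forall (h : MorphicSystem φ ψ P I L) (hT : NoBrokenRun P k L)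
    {y : List A} (hy : y ∈ I)
    (hc : ∀ c ∈ y, Simple P k (fun N => ((wordMap φ)^[N] [c]).map ψ)) :
    Simple P k (fun N => ((wordMap φ)^[N] y).map ψ) := by
  induction y with
  | nil => exact Simple.const [] (by simp)
  | cons b y ih =>
    have hyI : y ∈ I := h.closed' _ hy _ (List.suffix_cons b y).isInfix
    have := Simple.append h.closed hT (hc b (by simp)) (ih hyI fun c hc' => hc c (by simp [hc']))
      (Eventually.of_forall fun N => by
        rw [← List.map_append, ← iterate_wordMap_cons]
        exact h.map_mem _ (h.iterate_mem hy N))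
    simpa only [← List.map_append, ← iterate_wordMap_cons] using this

theorem MorphicSystem.simpleUpTo (h : MorphicSystem φ ψ P I L)
    (hT : ∀ j, j < k → NoBrokenRun P j L) : SimpleUpTo φ ψ P I k := by
  induction k with
  | zero => trivial
  | succ k ih =>
    intro y hy hyk
    have hT' : ∀ j, j < k → NoBrokenRun P j L := fun j hj => hT j (by omega)
    have hS := ih hT'
    obtain ⟨m, hm⟩ := exists_iterate_idempotent h.first hyk
    refine Simple.of_add (m := m) ?_
    simp only [Function.iterate_add_apply]
    have hmI := h.iterate_mem hy m
    refine h.simple_of_forall (hT k (Nat.lt_succ_self k)) hmI fun c hc => ?_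
    have hcI : [c] ∈ I := by
      obtain ⟨s, t, hst⟩ := List.append_of_mem hc
      exact h.closed' _ hmI _ ⟨s, t, by rw [hst]; simp⟩
    by_cases hck : c ∈ level φ k
    · exact hS.simple hcI (by simpa using hck)
    · obtain ⟨l, r, he, hl, hr⟩ := hm c hc hck
      exact h.simple_of_idempotent hT' hS hcI he hl hr

/-- A family of growing prefixes followed by arbitrary words. -/
theorem PrefixStable.of_prefix_succ_append {ρ : ℕ → ℕ} {w : ℕ → List B}
    (h : ∀ N, w N <+: w (N + 1)) (hρ : ∀ N, ρ N ≤ (w N).length) (t : ℕ → List B) :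
    PrefixStable ρ (fun N => w N ++ t N) := by
  refine ⟨0, 0, fun N _ r hr hl => ?_⟩
  have hρN := hρ N
  have hr : r <+: w N := List.prefix_of_prefix_length_le hr (List.prefix_append _ _) (by omega)
  filter_upwards [eventually_ge_atTop N] with M hM
  refine List.IsPrefix.trans ?_ (List.prefix_append _ _)
  induction M, hM using Nat.le_induction with
  | base => exact hr
  | succ M _ ih => exact ih.trans (h M)

theorem exists_first_out_of_wordMap {E : Set A} {y y₁ y₂ : List A} {d : A}
    (h : wordMap φ y = y₁ ++ d :: y₂) (hy₁ : ∀ c ∈ y₁, c ∈ E) :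
    ∃ e u v, e ∈ y ∧ φ e = u ++ d :: v ∧ ∀ c ∈ u, c ∈ E := by
  induction y generalizing y₁ with
  | nil => simp at h
  | cons b y ih =>
    rw [wordMap_cons, List.append_eq_append_iff] at h
    rcases h with ⟨t, rfl, h⟩ | ⟨t, h, h'⟩
    · obtain ⟨e, u, v, he, h⟩ := ih h fun c hc => hy₁ c (by simp [hc])
      exact ⟨e, u, v, by simp [he], h⟩
    · cases t with
      | nil =>
        obtain ⟨e, u, v, he, h⟩ := ih (y₁ := []) (by simpa using h'.symm) (by simp)
        exact ⟨e, u, v, by simp [he], h⟩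
      | cons c t =>
        simp only [List.cons_append, List.cons.injEq] at h'
        obtain ⟨rfl, -⟩ := h'
        exact ⟨b, y₁, t, by simp, h, hy₁⟩

/-- The images of a letter which reproduces itself and is not of level `k + 1` are, up to a
simple prefix, stable. -/
theorem MorphicSystem.exists_simple_append_stable (h : MorphicSystem φ ψ P I L) {ρ : ℕ → ℕ}
    (hρ : ∀ b ∉ level φ k, ∀ N, ρ N ≤ ∑ i ∈ Finset.range N, ((wordMap φ)^[i] [b]).length)
    (hT : NoBrokenRun P k L) {d : A} {u v : List A} (hdI : [d] ∈ I)
    (hd : φ d = u ++ [d] ++ v) (hu : ∀ c ∈ u, c ∈ level φ (k + 1)) (hdk : d ∉ level φ (k + 1))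
    (t : ℕ → List B) :
    ∃ x w, Simple P k x ∧ PrefixStable ρ w ∧
      ∀ᶠ N in atTop, ((wordMap φ)^[N] [d]).map ψ ++ t N = x N ++ w N := by
  have hT' : ∀ j, j < k + 1 → NoBrokenRun P j L := fun j hj => hT.mono (by omega)
  have hS := h.simpleUpTo hT'
  by_cases huk : ∀ c ∈ u, c ∈ level φ k
  · have hT'' : ∀ j, j < k → NoBrokenRun P j L := fun j hj => hT.mono (by omega)
    obtain ⟨c, Z, p, s, hZ, hN⟩ := h.leftSum_run hT'' (h.simpleUpTo hT'') hdI hd huk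
    have hv : ¬ ∀ c ∈ v, c ∈ level φ k := by
      intro hv
      have hone : ∀ N, outCount (level φ k) ((wordMap φ)^[N] [d]) ≤ 1 := by
        intro N
        induction N with
        | zero => exact (outCount_le_length _ _).trans (by simp)
        | succ N ih =>
          rw [iterate_succ_singleton, hd, iterate_wordMap_append, iterate_wordMap_append,
            outCount_append, outCount_append,
            outCount_eq_zero.2 (forall_mem_level_iterate.2 huk),
            outCount_eq_zero.2 (forall_mem_level_iterate.2 hv)]
          omega
      exact hdk ⟨1, hone⟩
    push Not at hv
    obtain ⟨b, hbv, hb⟩ := hv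
    refine ⟨fun N => Z N ++ c, fun N => ([d] ++ rightSum φ v N).map ψ ++ t N, ?_, ?_, ?_⟩
    · exact ⟨Z, fun _ => [], p, s, [], [], c, hZ, Or.inr (by simp), by simp⟩
    · refine PrefixStable.of_prefix_succ_append (fun N => ?_) (fun N => ?_) t
      · exact List.IsPrefix.map ψ ⟨(wordMap φ)^[N] v, by simp [rightSum]⟩
      · refine (hρ b hb N).trans ?_
        rw [List.length_map, List.length_append, length_rightSum]
        exact (Finset.sum_le_sum fun i _ => length_iterate_le_of_mem hbv i).trans
          (Nat.le_add_left _ _)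
    · filter_upwards [hN] with N hN
      rw [iterate_eq_sums hd]
      simp [hN]
  · obtain ⟨c, Z, p, s, hZ, hN⟩ := h.leftSum_run hT' hS hdI hd hu
    push Not at huk
    obtain ⟨b, hbu, hb⟩ := huk
    have hlen : ∀ N, ∑ i ∈ Finset.range N, ((wordMap φ)^[i] [b]).length ≤
        (leftSum φ u N).length := fun N => by
      rw [length_leftSum]
      exact Finset.sum_le_sum fun i _ => length_iterate_le_of_mem hbu i
    have hZ' : IsRun P (k + 1) Z p s := by
      refine hZ.resolve_right fun hZ' => ?_
      obtain ⟨N, h1, h2⟩ := (hN.and (eventually_gt_atTop c.length)).exists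
      have h3 := hlen N
      rw [← List.length_map (f := ψ), h1, hZ'.1 N, List.nil_append] at h3
      have h4 : N ≤ ∑ i ∈ Finset.range N, ((wordMap φ)^[i] [b]).length := by
        calc N = ∑ i ∈ Finset.range N, 1 := by simp
          _ ≤ _ := Finset.sum_le_sum fun i _ => length_iterate_pos hb i
      omega
    refine ⟨fun _ => [], _, Simple.const [] (by simp), hZ'.append_prefixStable h.pos (ρ := ρ)
      c.length ?_ (fun N => c ++ ([d] ++ rightSum φ v N).map ψ ++ t N), ?_⟩
    · filter_upwards [hN] with N hN
      have h1 := (hρ b hb N).trans (hlen N)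
      rwa [← List.length_map (f := ψ), hN, List.length_append] at h1
    · filter_upwards [hN] with N hN
      rw [iterate_eq_sums hd]
      simp [hN]

/-- The images of a word are stable or start with a run followed by a break. -/
theorem MorphicSystem.stable_or_break (h : MorphicSystem φ ψ P I L) {ρ : ℕ → ℕ}
    (hρ : ∀ b ∉ level φ k, ∀ N, ρ N ≤ ∑ i ∈ Finset.range N, ((wordMap φ)^[i] [b]).length)
    (hT : NoBrokenRun P k L) {y : List A} (hy : y ∈ I) :
    PrefixStable ρ (fun N => ((wordMap φ)^[N + 1] y).map ψ) ∨
      RunThenBreak P k ρ (fun N => ((wordMap φ)^[N + 1] y).map ψ) := by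
  have hS : SimpleUpTo φ ψ P I (k + 1) := h.simpleUpTo fun j hj => hT.mono (by omega)
  have hyI := h.wordMap_mem y hy
  simp only [Function.iterate_succ_apply]
  by_cases hyk : ∀ c ∈ wordMap φ y, c ∈ level φ (k + 1)
  · simpa using Simple.append_stable h.pos h.closed hT (hS _ hyI hyk) (prefixStable_nil (ρ := ρ))
      (Eventually.of_forall fun N => by simpa using h.map_mem _ (h.iterate_mem hyI N))
  · obtain ⟨y₁, d, y₂, hd, hy₁, hdk⟩ := exists_first_out hyk
    obtain ⟨e, u', v', he, he', hu'⟩ := exists_first_out_of_wordMap hd hy₁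
    obtain ⟨u, v, huv, hu⟩ := h.first _ e u' d v' he' hu' hdk
    have hdI : [d] ∈ I := h.closed' _ hyI _ ⟨y₁, y₂, by simp [hd]⟩
    have hy₁I : y₁ ∈ I := h.closed' _ hyI _ ⟨[], d :: y₂, by simp [hd]⟩
    obtain ⟨x, w, hx, hw, hxw⟩ := h.exists_simple_append_stable hρ hT hdI (by simpa using huv) hu
      hdk (fun N => ((wordMap φ)^[N] y₂).map ψ)
    have hxw' : ∀ᶠ N in atTop, ((wordMap φ)^[N] (wordMap φ y)).map ψ =
        (((wordMap φ)^[N] y₁).map ψ ++ x N) ++ w N := by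
      filter_upwards [hxw] with N hN
      rw [hd, iterate_wordMap_append, iterate_wordMap_cons, List.append_assoc, ← hN]
      simp
    have hmem : ∀ᶠ N in atTop, (((wordMap φ)^[N] y₁).map ψ ++ x N) ++ w N ∈ L := by
      filter_upwards [hxw'] with N hN
      rw [← hN]
      exact h.map_mem _ (h.iterate_mem hyI N)
    have hsimple := Simple.append h.closed hT (hS _ hy₁I hy₁) hx (by
      filter_upwards [hmem] with N hN using h.closed _ hN _ (List.prefix_append _ _).isInfix)
    exact (Simple.append_stable h.pos h.closed hT hsimple hw hmem).imp
      (·.congr hxw') (·.congr hxw')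

end Systems

section UpperBound

variable {A B : Type*} {P k : ℕ}

theorem IsCut.map {x y w : List A} (h : IsCut x y w) (ψ : A → B) :
    IsCut (x.map ψ) (y.map ψ) (w.map ψ) := by
  obtain ⟨w₁, w₂, h1, h2, rfl, h3, h4⟩ := h
  exact ⟨w₁.map ψ, w₂.map ψ, by simpa, by simpa, by simp, h3.map ψ, h4.map ψ⟩

theorem infix_append_cases {w x y : List A} (h : w <:+: x ++ y) :
    w <:+: x ∨ w <:+: y ∨ IsCut x y w := by
  obtain ⟨s, t, hst⟩ := h
  rw [List.append_eq_append_iff] at hst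
  rcases hst with ⟨r, h1, -⟩ | ⟨r, h1, rfl⟩
  · exact Or.inl ⟨s, r, h1.symm⟩
  · rw [List.append_eq_append_iff] at h1
    rcases h1 with ⟨q, rfl, rfl⟩ | ⟨q, rfl, h1⟩
    · by_cases hq : q = []
      · exact Or.inr (Or.inl ⟨[], t, by simp [hq]⟩)
      · by_cases hr : r = []
        · exact Or.inl ⟨s, [], by simp [hr]⟩
        · exact Or.inr (Or.inr ⟨q, r, hq, hr, rfl, ⟨s, rfl⟩, ⟨t, rfl⟩⟩)
    · exact Or.inr (Or.inl ⟨q, t, by rw [h1]⟩)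

theorem exists_cut_of_infix (φ : A → List A) {M : ℕ} {y w : List A}
    (hw : w <:+: (wordMap φ)^[M] y) (hne : w ≠ []) :
    (∃ c ∈ y, w <:+: (wordMap φ)^[M] [c]) ∨
      ∃ x' y', y = x' ++ y' ∧ IsCut ((wordMap φ)^[M] x') ((wordMap φ)^[M] y') w := by
  induction y with
  | nil => simp_all
  | cons b y ih =>
    rw [iterate_wordMap_cons] at hw
    rcases infix_append_cases hw with h | h | h
    · exact Or.inl ⟨b, by simp, h⟩
    · rcases ih h with ⟨c, hc, h⟩ | ⟨x', y', rfl, w₁, w₂, h1, h2, h3, h4, h5⟩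
      · exact Or.inl ⟨c, by simp [hc], h⟩
      · refine Or.inr ⟨b :: x', y', rfl, w₁, w₂, h1, h2, h3, ?_, h5⟩
        rw [iterate_wordMap_cons]
        exact h4.trans (List.suffix_append _ _)
    · exact Or.inr ⟨[b], y, rfl, h⟩

/-- Every factor of length at least two of an iterate occurs across a cut inside the iterated
image of a letter. -/
theorem exists_letter_cut {φ : A → List A} {M : ℕ} {a : A} {w : List A}
    (hw : w <:+: (wordMap φ)^[M] [a]) (hlen : 2 ≤ w.length) :
    ∃ K b x y N, b ∈ (wordMap φ)^[K] [a] ∧ φ b = x ++ y ∧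
      IsCut ((wordMap φ)^[N] x) ((wordMap φ)^[N] y) w := by
  induction M generalizing a with
  | zero =>
    have := hw.length_le
    simp at this
    omega
  | succ M ih =>
    rw [iterate_succ_singleton] at hw
    rcases exists_cut_of_infix φ hw (by rintro rfl; simp at hlen) with ⟨c, hc, h⟩ | ⟨x, y, h1, h2⟩
    · obtain ⟨K, b, x, y, N, hb, h1, h2⟩ := ih h
      refine ⟨K + 1, b, x, y, N, ?_, h1, h2⟩
      rw [iterate_succ_singleton, mem_iterate_iff]
      exact ⟨c, hc, hb⟩
    · exact ⟨0, a, x, y, M, by simp, h1, h2⟩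

theorem ncard_iUnion_fin_le {α : Type*} {m K : ℕ} {S : ℕ → Set α}
    (h : ∀ i, (S i).Finite ∧ (S i).ncard ≤ K) :
    (⋃ i ∈ Finset.range m, S i).Finite ∧ (⋃ i ∈ Finset.range m, S i).ncard ≤ m * K := by
  have hfin : (⋃ i ∈ Finset.range m, S i).Finite :=
    Set.Finite.biUnion (Finset.finite_toSet _) fun i _ => (h i).1
  refine ⟨hfin, ?_⟩
  induction m with
  | zero => simp
  | succ m ih =>
    have hfin' : (⋃ i ∈ Finset.range m, S i).Finite :=
      Set.Finite.biUnion (Finset.finite_toSet _) fun i _ => (h i).1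
    rw [Finset.range_add_one, Finset.set_biUnion_insert]
    refine (Set.ncard_union_le _ _).trans ?_
    have := ih hfin'
    have := (h m).2
    rw [Nat.succ_mul]
    omega

/-- A bound for the number of words of length `n` across the cuts between `X N` and `Y N`, for
all `N`. -/
theorem FewCuts.exists_bound {ρ κ : ℕ → ℕ} {X Y : ℕ → List B}
    (hκ : ∀ m N, κ m ≤ N → m ≤ ρ N)
    (h : FewCuts ρ (fun N => X (N + 1)) (fun N => Y (N + 1))) :
    ∃ C c₀, ∀ n, {w | w.length = n ∧ ∃ N, IsCut (X N) (Y N) w}.Finite ∧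
      {w | w.length = n ∧ ∃ N, IsCut (X N) (Y N) w}.ncard ≤
        C * ((n + 1) * (κ (n + c₀) + 1)) := by
  obtain ⟨C, N₀, c₀, h⟩ := h
  refine ⟨C + (N₀ + 1), c₀, fun n => ?_⟩
  set m := N₀ + κ (n + c₀) + 1
  have hsub : {w | w.length = n ∧ ∃ N, IsCut (X N) (Y N) w} ⊆
      cutWords ρ (fun N => X (N + 1)) (fun N => Y (N + 1)) N₀ c₀ n ∪
        ⋃ i ∈ Finset.range m, {w | w.length = n ∧ IsCut (X i) (Y i) w} := by
    rintro w ⟨hw, N, hN⟩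
    by_cases hNm : N < m
    · right
      simp only [Set.mem_iUnion]
      exact ⟨N, by simpa using hNm, hw, hN⟩
    · left
      obtain ⟨N, rfl⟩ := Nat.exists_eq_add_of_le' (show 1 ≤ N by omega)
      exact ⟨hw, N, by omega, hκ _ _ (by omega), hN⟩
  obtain ⟨h1, h2⟩ := ncard_iUnion_fin_le (m := m) (fun i => ncard_isCut_le (X i) (Y i) n)
  have hfin := (h n).1.union h1
  refine ⟨hfin.subset hsub, (Set.ncard_le_ncard hsub hfin).trans
    ((Set.ncard_union_le _ _).trans ((add_le_add (h n).2 h2).trans ?_))⟩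
  simp only [m]
  have e1 : N₀ + κ (n + c₀) + 1 ≤ (N₀ + 1) * (κ (n + c₀) + 1) := by nlinarith
  have e2 : C * (n + 1) ≤ C * ((n + 1) * (κ (n + c₀) + 1)) :=
    Nat.mul_le_mul le_rfl (Nat.le_mul_of_pos_right _ (Nat.succ_pos _))
  calc C * (n + 1) + (N₀ + κ (n + c₀) + 1) * (n + 1)
      ≤ C * ((n + 1) * (κ (n + c₀) + 1)) + (N₀ + 1) * (κ (n + c₀) + 1) * (n + 1) :=
        add_le_add e2 (Nat.mul_le_mul e1 le_rfl)
    _ = _ := by ring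

variable {φ : A → List A} {ψ : A → B} {I : Set (List A)} {L : Set (List B)}

theorem MorphicSystem.exists_cut_bound [Fintype B] (h : MorphicSystem φ ψ P I L) {ρ κ : ℕ → ℕ}
    (hρ : ∀ b ∉ level φ k, ∀ N, ρ N ≤ ∑ i ∈ Finset.range N, ((wordMap φ)^[i] [b]).length)
    (hκ : ∀ m N, κ m ≤ N → m ≤ ρ N) (hT : NoBrokenRun P k L) {x y : List A} (hxy : x ++ y ∈ I) :
    ∃ C c₀, ∀ n,
      {w | w.length = n ∧ ∃ N, IsCut (((wordMap φ)^[N] x).map ψ)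
        (((wordMap φ)^[N] y).map ψ) w}.Finite ∧
      {w | w.length = n ∧ ∃ N, IsCut (((wordMap φ)^[N] x).map ψ)
        (((wordMap φ)^[N] y).map ψ) w}.ncard ≤ C * ((n + 1) * (κ (n + c₀) + 1)) := by
  refine FewCuts.exists_bound (X := fun N => ((wordMap φ)^[N] x).map ψ)
    (Y := fun N => ((wordMap φ)^[N] y).map ψ) hκ
    (fewCuts h.pos h.closed hT (Eventually.of_forall fun N => ?_) ?_ ?_)
  · rw [← List.map_append, ← iterate_wordMap_append]
    exact h.map_mem _ (h.iterate_mem hxy _)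
  · have hx : x ∈ I := h.closed' _ hxy _ (List.prefix_append _ _).isInfix
    have := h.reverse.stable_or_break (ρ := ρ) (k := k) (y := x.reverse) (by
      rw [level_revMorphism]
      simpa [iterate_revMorphism] using hρ) hT.reverse (by simpa using hx)
    simpa [iterate_revMorphism, -Function.iterate_succ] using this
  · exact h.stable_or_break hρ hT (h.closed' _ hxy _ (List.suffix_append _ _).isInfix)

/-- An upper bound for the number of factors of the iterates of a letter. -/
theorem MorphicSystem.exists_factor_bound [Finite A] [Fintype B] (h : MorphicSystem φ ψ P I L)
    {ρ κ : ℕ → ℕ}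
    (hρ : ∀ b ∉ level φ k, ∀ N, ρ N ≤ ∑ i ∈ Finset.range N, ((wordMap φ)^[i] [b]).length)
    (hκ : ∀ m N, κ m ≤ N → m ≤ ρ N) (hκ' : Monotone κ) (hT : NoBrokenRun P k L) {a : A}
    (ha : [a] ∈ I) :
    ∃ C c₀, ∀ n, 2 ≤ n →
      {w | w.length = n ∧ ∃ N, w <:+: ((wordMap φ)^[N] [a]).map ψ}.ncard ≤
        C * ((n + 1) * (κ (n + c₀) + 1)) := by
  classical
  have := Fintype.ofFinite A
  have key : ∀ i : (b : A) × Fin ((φ b).length + 1), ∃ C c₀, φ i.1 ∈ I → ∀ n,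
      {w | w.length = n ∧ ∃ N, IsCut (((wordMap φ)^[N] ((φ i.1).take i.2)).map ψ)
        (((wordMap φ)^[N] ((φ i.1).drop i.2)).map ψ) w}.Finite ∧
      {w | w.length = n ∧ ∃ N, IsCut (((wordMap φ)^[N] ((φ i.1).take i.2)).map ψ)
        (((wordMap φ)^[N] ((φ i.1).drop i.2)).map ψ) w}.ncard ≤
          C * ((n + 1) * (κ (n + c₀) + 1)) := by
    intro i
    by_cases hi : φ i.1 ∈ I
    · obtain ⟨C, c₀, hC⟩ := h.exists_cut_bound hρ hκ hT
        (x := (φ i.1).take i.2) (y := (φ i.1).drop i.2) (by simpa using hi)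
      exact ⟨C, c₀, fun _ => hC⟩
    · exact ⟨0, 0, fun h => absurd h hi⟩
  choose C c₀ hC using key
  refine ⟨∑ i, C i, ∑ i, c₀ i, fun n hn => ?_⟩
  set S : (b : A) × Fin ((φ b).length + 1) → Set (List B) := fun i =>
    if φ i.1 ∈ I then {w | w.length = n ∧
      ∃ N, IsCut (((wordMap φ)^[N] ((φ i.1).take i.2)).map ψ)
        (((wordMap φ)^[N] ((φ i.1).drop i.2)).map ψ) w} else ∅
  have hS : ∀ i, (S i).Finite ∧
      (S i).ncard ≤ C i * ((n + 1) * (κ (n + ∑ i, c₀ i) + 1)) := by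
    intro i
    by_cases hi : φ i.1 ∈ I
    · simp only [S, if_pos hi]
      refine ⟨(hC i hi n).1, (hC i hi n).2.trans ?_⟩
      have : κ (n + c₀ i) ≤ κ (n + ∑ i, c₀ i) :=
        hκ' (add_le_add le_rfl (Finset.single_le_sum (f := c₀) (by simp) (Finset.mem_univ i)))
      gcongr
    · simp [S, if_neg hi]
  have hsub : {w | w.length = n ∧ ∃ N, w <:+: ((wordMap φ)^[N] [a]).map ψ} ⊆
      ⋃ i, S i := by
    rintro w ⟨hw, N, hN⟩
    obtain ⟨w', hw', rfl⟩ : ∃ w', w' <:+: (wordMap φ)^[N] [a] ∧ w = w'.map ψ := by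
      obtain ⟨s, t, hst⟩ := hN
      obtain ⟨l₁, l₂, h1, h2, h3⟩ := List.map_eq_append_iff.1 hst.symm
      obtain ⟨l₃, l₄, rfl, h5, h6⟩ := List.map_eq_append_iff.1 h2
      exact ⟨l₄, ⟨l₃, l₂, h1.symm⟩, h6.symm⟩
    obtain ⟨K, b, x, y, M, hb, hxy, hcut⟩ := exists_letter_cut hw' (by simp at hw; omega)
    have hbI : φ b ∈ I := by
      obtain ⟨s, t, hst⟩ := List.append_of_mem hb
      have : [b] ∈ I := h.closed' _ (h.iterate_mem ha K) _ ⟨s, t, by rw [hst]; simp⟩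
      simpa using h.wordMap_mem _ this
    refine Set.mem_iUnion.2 ⟨⟨b, ⟨x.length, by simp [hxy]⟩⟩, ?_⟩
    simp only [S, if_pos hbI]
    refine ⟨hw, M, ?_⟩
    simpa [hxy] using hcut.map ψ
  have hfin : (⋃ i, S i).Finite := Set.finite_iUnion fun i => (hS i).1
  refine (Set.ncard_le_ncard hsub hfin).trans ?_
  have hsum : (⋃ i, S i).ncard ≤ ∑ i, (S i).ncard := by
    have := Finset.set_ncard_biUnion_le Finset.univ S
    simpa using this
  refine hsum.trans ?_
  rw [Finset.sum_mul]
  exact Finset.sum_le_sum fun i _ => (hS i).2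

end UpperBound

/-! ### Growth of eventually polynomial sequences -/

/-- The integer sequence `f` grows like `N ^ e`. -/
def GrowsLike (e : ℕ) (f : ℕ → ℤ) : Prop :=
  ∃ M : ℕ, 0 < M ∧ ∀ᶠ N : ℕ in atTop, (N : ℤ) ^ e ≤ M * f N ∧ f N ≤ M * (N : ℤ) ^ e

theorem GrowsLike.of_diff {e : ℕ} {f : ℕ → ℤ} (h : GrowsLike e fun N => f (N + 1) - f N) :
    GrowsLike (e + 1) f ∧ ∀ᶠ N in atTop, f N < f (N + 1) := by
  obtain ⟨M, hM, h⟩ := h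
  obtain ⟨N₀, h⟩ := eventually_atTop.1 (h.and (eventually_ge_atTop 1))
  have hstep : ∀ N, N₀ ≤ N → f N < f (N + 1) := by
    intro N hN
    obtain ⟨⟨h1, -⟩, h2⟩ := h N hN
    have : (0 : ℤ) < (N : ℤ) ^ e := by positivity
    have h3 : (0 : ℤ) < M * (f (N + 1) - f N) := by linarith
    have := pos_of_mul_pos_right h3 (by positivity)
    linarith
  refine ⟨?_, eventually_atTop.2 ⟨N₀, hstep⟩⟩
  have hlin : ∀ i, f N₀ + i ≤ f (N₀ + i) := by
    intro i
    induction i with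
    | zero => simp
    | succ i ih =>
      have := hstep (N₀ + i) (by omega)
      push_cast
      change _ ≤ f (N₀ + i + 1)
      linarith [Int.add_one_le_of_lt this]
  set K : ℕ := (e + 1) * 2 ^ e with hK
  have hup : ∀ i, f (N₀ + i) ≤ |f N₀| + M * ((N₀ + i : ℕ) : ℤ) ^ (e + 1) := by
    intro i
    induction i with
    | zero =>
      have : (0 : ℤ) ≤ M * ((N₀ : ℕ) : ℤ) ^ (e + 1) := by positivity
      simp only [add_zero]
      linarith [le_abs_self (f N₀)]
    | succ i ih =>
      obtain ⟨⟨-, h1⟩, h2⟩ := h (N₀ + i) (by omega)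
      set x := N₀ + i
      rw [← add_assoc]
      have h3 : (x : ℤ) ^ (e + 1) + (x : ℤ) ^ e ≤ ((x + 1 : ℕ) : ℤ) ^ (e + 1) := by
        have : (x : ℤ) ^ e ≤ ((x : ℤ) + 1) ^ e := by gcongr; linarith
        push_cast
        calc (x : ℤ) ^ (e + 1) + (x : ℤ) ^ e = (x : ℤ) ^ e * (x + 1) := by ring
          _ ≤ ((x : ℤ) + 1) ^ e * (x + 1) := by gcongr
          _ = _ := by ring
      have h4 := mul_le_mul_of_nonneg_left h3 (show (0 : ℤ) ≤ M by positivity)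
      linarith
  have hlow : ∀ i, ((N₀ + i : ℕ) : ℤ) ^ (e + 1) ≤
      K * M * f (N₀ + i) + (K * M * |f N₀| + (N₀ : ℤ) ^ (e + 1)) := by
    intro i
    induction i with
    | zero =>
      have : (K : ℤ) * M * (-f N₀) ≤ K * M * |f N₀| := by
        gcongr
        exact neg_le_abs _
      simp only [add_zero]
      linarith
    | succ i ih =>
      obtain ⟨⟨h1, -⟩, h2⟩ := h (N₀ + i) (by omega)
      set x := N₀ + i
      rw [← add_assoc]
      have h3 : ((x + 1 : ℕ) : ℤ) ^ (e + 1) ≤ (x : ℤ) ^ (e + 1) + K * (x : ℤ) ^ e := by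
        have h5 : ((x : ℤ) + 1) ^ (e + 1) ≤ (x : ℤ) ^ (e + 1) + (e + 1) * ((x : ℤ) + 1) ^ e := by
          clear * -
          induction e with
          | zero => simp
          | succ e ih =>
            have : (x : ℤ) ^ (e + 1) ≤ ((x : ℤ) + 1) ^ (e + 1) := by gcongr; linarith
            have h6 := mul_le_mul_of_nonneg_right ih (show (0 : ℤ) ≤ x + 1 by positivity)
            push_cast
            calc ((x : ℤ) + 1) ^ (e + 1 + 1) = ((x : ℤ) + 1) ^ (e + 1) * (x + 1) := by ring
              _ ≤ ((x : ℤ) ^ (e + 1) + (e + 1) * ((x : ℤ) + 1) ^ e) * (x + 1) := h6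
              _ = (x : ℤ) ^ (e + 1 + 1) + (x : ℤ) ^ (e + 1) + (e + 1) * ((x : ℤ) + 1) ^ (e + 1) := by
                ring
              _ ≤ _ := by linarith
        have h6 : ((x : ℤ) + 1) ^ e ≤ 2 ^ e * (x : ℤ) ^ e := by
          rw [← mul_pow]
          gcongr
          have : (1 : ℤ) ≤ x := by exact_mod_cast h2
          linarith
        have h7 := mul_le_mul_of_nonneg_left h6 (show (0 : ℤ) ≤ e + 1 by positivity)
        rw [hK]
        push_cast
        linarith
      have h4 := mul_le_mul_of_nonneg_left h1 (show (0 : ℤ) ≤ K by positivity)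
      linarith
  set C : ℤ := K * M * |f N₀| + (N₀ : ℤ) ^ (e + 1) with hC
  refine ⟨K * M + M + 1, by positivity, eventually_atTop.2
    ⟨N₀ + ((|f N₀| + |C|).toNat + |f N₀|.toNat + 1), fun N hN => ?_⟩⟩
  obtain ⟨i, rfl⟩ := Nat.exists_eq_add_of_le (show N₀ ≤ N by omega)
  have h1 := hup i
  have h2 := hlow i
  have h3 := hlin i
  have h0 := neg_le_abs (f N₀)
  have hCabs := le_abs_self C
  have habs := abs_nonneg (f N₀)
  have habs' := abs_nonneg C
  have hi : |f N₀| + |C| ≤ i := by omega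
  have h4 : C ≤ f (N₀ + i) := by linarith
  have h5 : 0 ≤ f (N₀ + i) := by linarith
  have hM0 : 0 ≤ (M : ℤ) * f (N₀ + i) := by positivity
  push_cast at *
  constructor
  · linarith
  · have h6 : |f N₀| ≤ ((N₀ : ℤ) + i) ^ (e + 1) := by
      have : (1 : ℤ) ≤ (N₀ : ℤ) + i := by omega
      calc |f N₀| ≤ (N₀ : ℤ) + i := by linarith [Int.natCast_nonneg N₀]
        _ ≤ _ := le_self_pow₀ this (by omega)
    have h7 : 0 ≤ (K : ℤ) * M * ((N₀ : ℤ) + i) ^ (e + 1) := by positivity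
    linarith

theorem GrowsLike.of_const {f : ℕ → ℤ} {c : ℤ} (hc : 0 < c) (h : ∀ᶠ N in atTop, f N = c) :
    GrowsLike 0 f := by
  refine ⟨c.toNat, by omega, h.mono fun N hN => ?_⟩
  rw [hN, pow_zero, Int.toNat_of_nonneg hc.le]
  constructor <;> nlinarith

theorem eventually_eq_const_of_diff_eq_zero {f : ℕ → ℤ}
    (h : ∀ᶠ N in atTop, f (N + 1) - f N = 0) : ∃ c, ∀ᶠ N in atTop, f N = c := by
  obtain ⟨N₀, h⟩ := eventually_atTop.1 h
  refine ⟨f N₀, eventually_atTop.2 ⟨N₀, fun N hN => ?_⟩⟩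
  induction N, hN using Nat.le_induction with
  | base => rfl
  | succ N hN ih => linarith [h N hN]

theorem EvPoly.trichotomy {d : ℕ} {f : ℕ → ℤ} (h : EvPoly d f) :
    (∀ᶠ N in atTop, f N = 0) ∨
      ∃ e ≤ d, GrowsLike e f ∨ GrowsLike e fun N => -f N := by
  have hconst : ∀ {d : ℕ} {f : ℕ → ℤ}, (∃ c, ∀ᶠ N in atTop, f N = c) →
      (∀ᶠ N in atTop, f N = 0) ∨
        ∃ e ≤ d, GrowsLike e f ∨ GrowsLike e fun N => -f N := by
    rintro d f ⟨c, hc⟩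
    rcases lt_trichotomy c 0 with h0 | rfl | h0
    · exact Or.inr ⟨0, by omega, Or.inr (.of_const (c := -c) (by omega) (hc.mono fun N h => by rw [h]))⟩
    · exact Or.inl hc
    · exact Or.inr ⟨0, by omega, Or.inl (.of_const h0 hc)⟩
  induction d generalizing f with
  | zero => exact hconst h
  | succ d ih =>
    rcases ih h with h0 | ⟨e, he, h1 | h1⟩
    · exact hconst (eventually_eq_const_of_diff_eq_zero h0)
    · exact Or.inr ⟨e + 1, by omega, Or.inl h1.of_diff.1⟩
    · refine Or.inr ⟨e + 1, by omega, Or.inr (GrowsLike.of_diff (f := fun N => -f N) ?_).1⟩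
      convert h1 using 2
      ring

/-- An unbounded eventually polynomial sequence of degree at most `d` grows like `N ^ e` with
`1 ≤ e ≤ d` and is eventually increasing. -/
theorem EvPoly.growsLike_of_tendsto {d : ℕ} {f : ℕ → ℤ} (h : EvPoly d f)
    (hf : Tendsto f atTop atTop) :
    ∃ e, 1 ≤ e ∧ e ≤ d ∧ GrowsLike e f ∧ ∀ᶠ N in atTop, f N < f (N + 1) := by
  have hnc : ¬ ∃ c, ∀ᶠ N in atTop, f N = c := by
    rintro ⟨c, hc⟩
    obtain ⟨N, h1, h2⟩ := (hc.and (hf.eventually_gt_atTop c)).exists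
    omega
  cases d with
  | zero => exact absurd h hnc
  | succ d =>
    rcases EvPoly.trichotomy (d := d) h with h0 | ⟨e, he, h1 | h1⟩
    · exact absurd (eventually_eq_const_of_diff_eq_zero h0) hnc
    · exact ⟨e + 1, by omega, by omega, h1.of_diff⟩
    · have h2 : GrowsLike e fun N => (fun N => -f N) (N + 1) - (fun N => -f N) N := by
        convert h1 using 2
        ring
      obtain ⟨⟨M, hM, h3⟩, -⟩ := GrowsLike.of_diff (f := fun N => -f N) h2
      obtain ⟨N, ⟨h4, -⟩, h5⟩ := (h3.and (hf.eventually_gt_atTop 0)).exists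
      have : (0 : ℤ) ≤ (N : ℤ) ^ (e + 1) := by positivity
      have : (0 : ℤ) < M * f N := by positivity
      linarith

section LowerBound

variable {B : Type*} {P k : ℕ} {β : ℕ → B}

theorem length_factorAt (β : ℕ → B) (i n : ℕ) : (factorAt β i n).length = n := by
  simp [factorAt]

theorem getElem?_factorAt {i n j : ℕ} (h : j < n) : (factorAt β i n)[j]? = some (β (i + j)) := by
  simp [factorAt, h]

/-- At the positions `i` and `i + m` the sequence `β` does not repeat after `P` letters, but it
does so at all positions in between. -/
structure IsGap (P : ℕ) (β : ℕ → B) (i m : ℕ) : Prop where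
  pos : 0 < m
  left : β i ≠ β (i + P)
  right : β (i + m) ≠ β (i + m + P)
  mid : ∀ j, 0 < j → j < m → β (i + j) = β (i + j + P)

theorem IsGap.length_unique {i m m' : ℕ} (h : IsGap P β i m) (h' : IsGap P β i m') : m = m' := by
  rcases lt_trichotomy m m' with hlt | heq | hlt
  · exact absurd (h'.mid m h.pos hlt) h.right
  · exact heq
  · exact absurd (h.mid m' h'.pos hlt) h'.right

theorem IsGap.le_of_lt {i m i' : ℕ} (h : IsGap P β i m) (h' : β i' ≠ β (i' + P)) (hlt : i < i') :
    i + m ≤ i' := by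
  by_contra hc
  exact h' (by simpa [Nat.add_sub_cancel' hlt.le] using h.mid (i' - i) (by omega) (by omega))

theorem IsGap.eq_of_div_eq {i m i' m' D : ℕ} (h : IsGap P β i m) (h' : IsGap P β i' m')
    (hm : D ≤ m) (hm' : D ≤ m') (hD : 0 < D) (hdiv : i / D = i' / D) : i = i' := by
  have h1 := Nat.div_add_mod i D
  have h2 := Nat.div_add_mod i' D
  have h3 := Nat.mod_lt i hD
  have h4 := Nat.mod_lt i' hD
  rw [hdiv] at h1
  rcases lt_trichotomy i i' with hlt | heq | hlt
  · have := h.le_of_lt h'.left hlt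
    omega
  · exact heq
  · have := h'.le_of_lt h.left hlt
    omega

theorem IsGap.congr {γ : ℕ → B} {i i' t m n : ℕ} (h : IsGap P β (i + t) m)
    (hn : t + m + P < n) (heq : factorAt β i n = factorAt γ i' n) : IsGap P γ (i' + t) m := by
  have key : ∀ j < n, β (i + j) = γ (i' + j) := fun j hj => by
    have := congrArg (·[j]?) heq
    simpa [getElem?_factorAt hj] using this
  refine ⟨h.pos, ?_, ?_, fun j h1 h2 => ?_⟩
  · rw [add_assoc, ← key _ (by omega), ← key _ (by omega), ← add_assoc]
    exact h.left
  · rw [add_assoc, add_assoc, add_assoc, ← key _ (by omega), ← key _ (by omega),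
      ← add_assoc, ← add_assoc, ← add_assoc]
    exact h.right
  · rw [add_assoc, add_assoc, add_assoc, ← key _ (by omega), ← key _ (by omega),
      ← add_assoc, ← add_assoc, ← add_assoc]
    exact h.mid j h1 h2

theorem finite_setOf_isFactor [Finite B] (β : ℕ → B) (n : ℕ) :
    {w : List B | w.length = n ∧ IsFactor β w}.Finite :=
  (List.finite_length_eq B n).subset fun _ h => h.1

/-- Many gaps of different lengths, all comparable to `n`, yield many factors of length `n`. -/
theorem card_gaps_le_complexity [Finite B] {n D K : ℕ} {J : Finset ℕ} {i m : ℕ → ℕ}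
    (hD : 0 < D) (hK : n < K * D) (hP : 4 * P < n) (hm : Set.InjOn m J)
    (hgap : ∀ j ∈ J, IsGap P β (i j) (m j)) (hlow : ∀ j ∈ J, D ≤ m j)
    (hup : ∀ j ∈ J, 4 * m j ≤ n) :
    (J.card - K) * (n / 2) ≤ K * complexity β n := by
  classical
  have hfin := finite_setOf_isFactor β n
  have hdiv : ∀ t < n, t / D < K := fun t ht => (Nat.div_lt_iff_lt_mul hD).2 (by omega)
  set J₁ := J.filter fun j => n ≤ i j
  have hJ₀ : (J.filter fun j => ¬ n ≤ i j).card ≤ K := by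
    rw [← Finset.card_range K]
    refine Finset.card_le_card_of_injOn (fun j => i j / D) ?_ ?_
    · intro j hj
      simp only [Finset.coe_filter, Set.mem_ofPred_eq] at hj
      simpa using hdiv _ (by omega)
    · intro j hj j' hj' heq
      simp only [Finset.coe_filter, Set.mem_ofPred_eq] at hj hj'
      have h1 := (hgap j hj.1).eq_of_div_eq (hgap j' hj'.1) (hlow j hj.1) (hlow j' hj'.1) hD heq
      refine hm hj.1 hj'.1 ((hgap j hj.1).length_unique ?_)
      rw [h1]
      exact hgap j' hj'.1
  have hJ₁ : J.card - K ≤ J₁.card := by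
    have : J₁.card + (J.filter fun j => ¬ n ≤ i j).card = J.card :=
      Finset.card_filter_add_card_filter_not _
    omega
  have hmain : (J₁ ×ˢ Finset.range (n / 2)).card ≤ K * hfin.toFinset.card := by
    refine Finset.card_le_mul_card_image_of_maps_to
      (f := fun x => factorAt β (i x.1 - x.2) n) ?_ K ?_
    · intro x _
      simp only [Set.Finite.mem_toFinset, Set.mem_ofPred_eq, length_factorAt, true_and]
      exact ⟨i x.1 - x.2, by rw [length_factorAt]⟩
    · intro w _
      rw [← Finset.card_range K]
      refine Finset.card_le_card_of_injOn (fun x => x.2 / D) ?_ ?_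
      · intro x hx
        simp only [Finset.coe_filter, Finset.mem_product, Finset.mem_range, Set.mem_ofPred_eq] at hx
        simpa using hdiv _ (by omega)
      · rintro ⟨j, t⟩ hx ⟨j', t'⟩ hx' heq
        simp only [J₁, Finset.coe_filter, Finset.mem_product, Finset.mem_range, Finset.mem_filter,
          Set.mem_ofPred_eq] at hx hx' heq
        obtain ⟨⟨⟨hj, hij⟩, ht⟩, hw⟩ := hx
        obtain ⟨⟨⟨hj', hij'⟩, ht'⟩, hw'⟩ := hx'
        have hg : ∀ {j t}, j ∈ J → n ≤ i j → t < n / 2 → factorAt β (i j - t) n = w →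
            IsGap P (fun s => w.getD s (β 0)) t (m j) := by
          intro j t hj hij ht hw
          have h1 := hgap j hj
          have h2 := hup j hj
          rw [← Nat.sub_add_cancel (show t ≤ i j by omega)] at h1
          have := h1.congr (γ := fun s => w.getD s (β 0)) (i' := 0) (n := n) (by omega) ?_
          · simpa using this
          · rw [hw]
            refine List.ext_getElem? fun s => ?_
            by_cases hs : s < n
            · rw [getElem?_factorAt hs, ← hw]
              simp [getElem?_factorAt hs]
            · rw [List.getElem?_eq_none (by rw [← hw, length_factorAt]; omega),
                List.getElem?_eq_none (by rw [length_factorAt]; omega)]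
        have h1 := hg hj hij ht hw
        have h2 := hg hj' hij' ht' hw'
        obtain rfl := h1.eq_of_div_eq h2 (hlow j hj) (hlow j' hj') hD heq
        rw [hm hj hj' (h1.length_unique h2)]
  rw [Finset.card_product, Finset.card_range, ← Set.ncard_eq_toFinset_card _ hfin] at hmain
  exact (Nat.mul_le_mul_right _ hJ₁).trans hmain

/-- A run that is broken on both sides is delimited by a gap. -/
theorem exists_isGap_of_not_hasPeriod {l r p s : List B} (hp : p.length = P) (hs : s.length = P)
    (hl : ¬ (l ++ p).HasPeriod P) (hr : ¬ (s ++ r).HasPeriod P) :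
    ∃ c : ℤ, ∀ z : List B, P ≤ z.length → p <+: z → s <:+ z → z.HasPeriod P →
      IsFactor β (l ++ z ++ r) → ∃ i m : ℕ, (m : ℤ) = z.length + c ∧ IsGap P β i m := by
  classical
  simp only [hasPeriod_iff_lt, not_forall] at hl hr
  obtain ⟨i₀, hi₀, hi₀l, hi₀m⟩ : ∃ i, (l ++ p)[i]? ≠ (l ++ p)[i + P]? ∧ i < l.length ∧
      ∀ j, i < j → j < l.length → (l ++ p)[j]? = (l ++ p)[j + P]? := by
    obtain ⟨i, hi, hne⟩ := hl
    have hi' : i < l.length := by simp [hp] at hi; omega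
    set Q : ℕ → Prop := fun i => (l ++ p)[i]? ≠ (l ++ p)[i + P]? ∧ i < l.length
    have hQ : Q (Nat.findGreatest Q l.length) :=
      Nat.findGreatest_spec (P := Q) hi'.le ⟨hne, hi'⟩
    refine ⟨_, hQ.1, hQ.2, fun j h1 h2 => ?_⟩
    by_contra hc
    exact Nat.findGreatest_is_greatest h1 h2.le ⟨hc, h2⟩
  obtain ⟨j₀, hj₀, hj₀l, hj₀m⟩ : ∃ j, (s ++ r)[j]? ≠ (s ++ r)[j + P]? ∧ j < r.length ∧
      ∀ i < j, (s ++ r)[i]? = (s ++ r)[i + P]? := by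
    have hex : ∃ j, (s ++ r)[j]? ≠ (s ++ r)[j + P]? ∧ j < r.length := by
      obtain ⟨j, hj, hne⟩ := hr
      exact ⟨j, hne, by simp [hs] at hj; omega⟩
    refine ⟨Nat.find hex, (Nat.find_spec hex).1, (Nat.find_spec hex).2, fun i hi => ?_⟩
    by_contra hc
    exact Nat.find_min hex hi ⟨hc, hi.trans (Nat.find_spec hex).2⟩
  refine ⟨l.length + j₀ - P - i₀, ?_⟩
  rintro z hPz ⟨z₁, rfl⟩ ⟨z₂, hz₂⟩ hz ⟨x, hx⟩
  set z := p ++ z₁ with hzdef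
  have hlen₂ : z₂.length + P = z.length := by rw [← hz₂]; simp [hs]
  set W := l ++ z ++ r with hW
  have hWlen : W.length = l.length + z.length + r.length := by simp [hW, add_assoc]
  have hβ : ∀ j < W.length, some (β (x + j)) = W[j]? := fun j hj => by
    conv_rhs => rw [hx]
    rw [getElem?_factorAt hj]
  have hW₁ : ∀ j < l.length + P, W[j]? = (l ++ p)[j]? := fun j hj => by
    have : W = (l ++ p) ++ (z₁ ++ r) := by simp [hW, hzdef]
    rw [this, List.getElem?_append_left (by simp [hp, hj])]
  have hW₂ : ∀ j < z.length, W[l.length + j]? = z[j]? := fun j hj => by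
    rw [hW, List.append_assoc, List.getElem?_append_right (by omega), Nat.add_sub_cancel_left,
      List.getElem?_append_left hj]
  have hW₃ : ∀ j, W[l.length + z₂.length + j]? = (s ++ r)[j]? := fun j => by
    have : W = (l ++ z₂) ++ (s ++ r) := by simp [hW, ← hz₂]
    rw [this, List.getElem?_append_right (by simp), List.length_append, Nat.add_sub_cancel_left]
  have heq : ∀ j, j + P < W.length → (β (x + j) = β (x + j + P) ↔ W[j]? = W[j + P]?) :=
    fun j hj => by
      rw [← hβ j (by omega), ← hβ _ hj, Option.some_inj, add_assoc]
  have hright : x + i₀ + (l.length + z₂.length + j₀ - i₀) = x + (l.length + z₂.length + j₀) := by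
    omega
  refine ⟨x + i₀, l.length + z₂.length + j₀ - i₀, by omega, by omega, ?_, ?_, fun j h1 h2 => ?_⟩
  · rw [Ne, heq _ (by omega), hW₁ _ (by omega), hW₁ _ (by omega)]
    exact hi₀
  · rw [hright, Ne, heq _ (by omega), hW₃, add_assoc, hW₃]
    exact hj₀
  · rw [add_assoc x, heq _ (by omega)]
    rcases lt_or_ge (i₀ + j) l.length with h3 | h3
    · rw [hW₁ _ (by omega), hW₁ _ (by omega)]
      exact hi₀m _ (by omega) h3
    · obtain ⟨t, ht⟩ := Nat.exists_eq_add_of_le h3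
      rw [ht]
      rcases lt_or_ge t z₂.length with h4 | h4
      · rw [hW₂ _ (by omega), add_assoc, hW₂ _ (by omega)]
        exact hasPeriod_iff_lt.1 hz _ (by omega)
      · obtain ⟨v, rfl⟩ := Nat.exists_eq_add_of_le h4
        rw [← add_assoc, hW₃, add_assoc, hW₃]
        exact hj₀m _ (by omega)

theorem exists_pow_le_lt_pow_succ {G e : ℕ} (hG : 0 < G) (he : 1 ≤ e) (n : ℕ) :
    ∃ X, G * X ^ e ≤ n ∧ n < G * (X + 1) ^ e := by
  have hex : ∃ y, n < G * y ^ e := by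
    refine ⟨n + 1, ?_⟩
    have h1 : n + 1 ≤ (n + 1) ^ e := Nat.le_self_pow (by omega) _
    have h2 : (n + 1) ^ e ≤ G * (n + 1) ^ e := Nat.le_mul_of_pos_left _ hG
    omega
  have hspec := Nat.find_spec hex
  have hmin := fun y => Nat.find_min hex (m := y)
  cases hY : Nat.find hex with
  | zero =>
    rw [hY, zero_pow (by omega)] at hspec
    omega
  | succ X =>
    rw [hY] at hspec hmin
    exact ⟨X, by simpa using hmin X (by omega), hspec⟩

/-- If runs of length growing polynomially with degree at most `k` occur in `β` and are broken on
both sides, then the complexity of `β` is at least of order `n ^ (1 + 1 / k)`. -/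
theorem isBigO_complexity_of_not_noBrokenRun [Finite B] {L : Set (List B)}
    (hL : ∀ w ∈ L, IsFactor β w) (h : ¬ NoBrokenRun P k L) :
    (fun n : ℕ => (n : ℝ) ^ ((1 : ℝ) + 1 / k)) =O[atTop] fun n => (complexity β n : ℝ) := by
  simp only [NoBrokenRun, not_forall, not_or] at h
  obtain ⟨z, p, s, l, r, hrun, hmem, hl, hr⟩ := h
  obtain ⟨c, hc⟩ :=
    exists_isGap_of_not_hasPeriod (β := β) hrun.length_prefix hrun.length_suffix hl hr
  set f : ℕ → ℤ := fun N => (z N).length + c with hf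
  have hftend : Tendsto f atTop atTop :=
    tendsto_atTop_add_const_right _ _ (tendsto_natCast_atTop_atTop.comp hrun.tendsto_length)
  obtain ⟨e, he, hek, ⟨M, hM, hgrow⟩, hstep⟩ :=
    (hrun.evPoly.add (EvPoly.const k c)).growsLike_of_tendsto hftend
  obtain ⟨N₀, hN₀⟩ := eventually_atTop.1 ((((hgrow.and hstep).and hrun.eventually_run).and hmem).and
    (hrun.tendsto_length.eventually_ge_atTop P))
  have hgap : ∀ N, ∃ i m : ℕ, N₀ ≤ N → (m : ℤ) = f N ∧ IsGap P β i m := by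
    intro N
    by_cases hN : N₀ ≤ N
    · obtain ⟨⟨⟨-, h1, h2, h3⟩, h4⟩, h5⟩ := hN₀ N hN
      obtain ⟨i, m, h6⟩ := hc (z N) h5 h1 h2 h3 (hL _ h4)
      exact ⟨i, m, fun _ => h6⟩
    · exact ⟨0, 0, fun h => absurd h hN⟩
  choose i m hgap using hgap
  have hmlow : ∀ N, N₀ ≤ N → N ^ e ≤ M * m N := fun N hN => by
    have := (hN₀ N hN).1.1.1.1.1
    change _ ≤ _ * f N at this
    rw [← (hgap N hN).1] at this
    exact_mod_cast this
  have hmup : ∀ N, N₀ ≤ N → m N ≤ M * N ^ e := fun N hN => by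
    have := (hN₀ N hN).1.1.1.1.2
    change f N ≤ _ at this
    rw [← (hgap N hN).1] at this
    exact_mod_cast this
  have hmono : ∀ N, N₀ ≤ N → ∀ N', N < N' → m N < m N' := by
    intro N hN N' hNN'
    induction N', hNN' using Nat.le_induction with
    | base =>
      have : f N < f (N + 1) := (hN₀ N hN).1.1.1.2
      rw [← (hgap N hN).1, ← (hgap (N + 1) (by omega)).1] at this
      exact_mod_cast this
    | succ N' hN' ih =>
      have : f N' < f (N' + 1) := (hN₀ N' (by omega)).1.1.1.2
      rw [← (hgap N' (by omega)).1, ← (hgap (N' + 1) (by omega)).1] at this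
      exact ih.trans (by exact_mod_cast this)
  set G := 4 * M * 2 ^ e with hG
  set H := G * 2 ^ e with hH
  set K := 2 * H * M with hK
  have hGpos : 0 < G := by positivity
  have hHpos : 0 < H := by positivity
  set X₀ := N₀ + M + 2 * K + 1 with hX₀
  refine IsBigO.of_bound (8 * K * H : ℕ) (eventually_atTop.2 ⟨G * (X₀ + 1) ^ e + 4 * P + 2,
    fun n hn => ?_⟩)
  obtain ⟨X, hX₁, hX₂⟩ := exists_pow_le_lt_pow_succ hGpos he n
  have hX : X₀ < X := by
    by_contra hcon
    have : G * (X + 1) ^ e ≤ G * (X₀ + 1) ^ e := by gcongr; omega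
    omega
  have hnX : n < H * X ^ e := by
    calc n < G * (X + 1) ^ e := hX₂
      _ ≤ G * (2 * X) ^ e := by gcongr; omega
      _ = H * X ^ e := by rw [hH, mul_pow]; ring
  have hMX : M ≤ X ^ e := (show M ≤ X by omega).trans (Nat.le_self_pow (by omega) _)
  have hDpos : 0 < X ^ e / M := Nat.div_pos hMX hM
  have hKD : n < K * (X ^ e / M) := by
    have h1 : X ^ e < M * (X ^ e / M + 1) := by
      rw [mul_comm]
      exact Nat.lt_mul_of_div_lt (by omega) hM
    have h2 : X ^ e ≤ 2 * M * (X ^ e / M) := by nlinarith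
    calc n < H * X ^ e := hnX
      _ ≤ H * (2 * M * (X ^ e / M)) := by gcongr
      _ = _ := by rw [hK]; ring
  have hcard := card_gaps_le_complexity (β := β) (P := P) (n := n) (J := Finset.Ico X (2 * X))
    (i := i) (m := m) hDpos hKD (by omega) ?_ ?_ ?_ ?_
  · have hXn : X * n ≤ 8 * K * complexity β n := by
      rw [Nat.card_Ico] at hcard
      have h1 : X ≤ 2 * (2 * X - X - K) := by omega
      have h2 : n ≤ 4 * (n / 2) := by omega
      calc X * n ≤ 2 * (2 * X - X - K) * (4 * (n / 2)) := Nat.mul_le_mul h1 h2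
        _ = 8 * ((2 * X - X - K) * (n / 2)) := by ring
        _ ≤ 8 * (K * complexity β n) := by gcongr
        _ = _ := by ring
    have hn1 : (1 : ℝ) ≤ n := by exact_mod_cast (show 1 ≤ n by omega)
    have hroot : (n : ℝ) ^ ((1 : ℝ) / k) ≤ (H * X : ℕ) := by
      have h1 : (n : ℝ) ^ ((1 : ℝ) / k) ≤ (n : ℝ) ^ ((1 : ℝ) / e) := by
        refine Real.rpow_le_rpow_of_exponent_le hn1 (one_div_le_one_div_of_le ?_ ?_)
        · exact_mod_cast he
        · exact_mod_cast hek
      have h2 : n ≤ (H * X) ^ e := by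
        rw [mul_pow]
        refine hnX.le.trans ?_
        gcongr
        exact Nat.le_self_pow (by omega) _
      refine h1.trans ?_
      calc (n : ℝ) ^ ((1 : ℝ) / e) ≤ (((H * X) ^ e : ℕ) : ℝ) ^ ((1 : ℝ) / e) := by
            gcongr
        _ = _ := by
            rw [Nat.cast_pow, one_div, Real.pow_rpow_inv_natCast (by positivity) (by omega)]
    rw [Real.rpow_add (by linarith), Real.rpow_one, Real.norm_of_nonneg (by positivity),
      Real.norm_of_nonneg (by positivity)]
    calc (n : ℝ) * (n : ℝ) ^ ((1 : ℝ) / k) ≤ n * (H * X : ℕ) := by gcongr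
      _ = H * ((X * n : ℕ) : ℝ) := by push_cast; ring
      _ ≤ H * ((8 * K * complexity β n : ℕ) : ℝ) := by gcongr
      _ = _ := by push_cast; ring
  · intro N hN N' hN' heq
    simp only [Finset.coe_Ico, Set.mem_Ico] at hN hN'
    rcases lt_trichotomy N N' with hlt | rfl | hlt
    · exact absurd heq (hmono N (by omega) N' hlt).ne
    · rfl
    · exact absurd heq (hmono N' (by omega) N hlt).ne'
  · intro N hN
    rw [Finset.mem_Ico] at hN
    exact (hgap N (by omega)).2
  · intro N hN
    rw [Finset.mem_Ico] at hN
    refine Nat.div_le_of_le_mul ((Nat.pow_le_pow_left hN.1 e).trans (hmlow N (by omega)))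
  · intro N hN
    rw [Finset.mem_Ico] at hN
    calc 4 * m N ≤ 4 * (M * N ^ e) := by gcongr; exact hmup N (by omega)
      _ ≤ 4 * (M * (2 * X) ^ e) := by gcongr; omega
      _ = G * X ^ e := by rw [mul_pow, hG]; ring
      _ ≤ n := hX₁

end LowerBound

section Factors

variable {B C : Type*}

theorem factorAt_add (β : ℕ → B) (i m n : ℕ) :
    factorAt β i (m + n) = factorAt β i m ++ factorAt β (i + m) n := by
  simp [factorAt, List.range_add, add_assoc]

theorem map_factorAt (ψ : B → C) (β : ℕ → B) (i n : ℕ) :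
    (factorAt β i n).map ψ = factorAt (fun j => ψ (β j)) i n := by
  simp [factorAt, Function.comp_def]

theorem isFactor_of_infix {β : ℕ → B} {w : List B} {n : ℕ} (h : w <:+: factorAt β 0 n) :
    IsFactor β w := by
  obtain ⟨x, y, hxy⟩ := h
  have hn : n = x.length + w.length + y.length := by
    simpa [length_factorAt, add_assoc] using (congrArg List.length hxy).symm
  rw [hn, factorAt_add, factorAt_add, zero_add] at hxy
  have h1 := (List.append_inj hxy (by simp [length_factorAt])).1
  exact ⟨x.length, (List.append_inj h1 (by simp [length_factorAt])).2⟩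

theorem factorAt_infix {β : ℕ → B} {i m n : ℕ} (h : i + m ≤ n) :
    factorAt β i m <:+: factorAt β 0 n := by
  obtain ⟨t, rfl⟩ := Nat.exists_eq_add_of_le h
  rw [factorAt_add, factorAt_add, zero_add]
  exact ⟨_, _, rfl⟩

/-- The factors of a morphic sequence are the factors of the images of the iterates. -/
theorem isFactor_iff_exists_infix {A : Type*} {φ : A → List A} {a : A} {α : ℕ → A} {ψ : A → B}
    (hpro : Prolongable φ a) (hfix : IsFixedSeq φ a α) {q : ℕ} (hq : 0 < q) (w : List B) :
    IsFactor (fun i => ψ (α i)) w ↔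
      ∃ N, w <:+: ((wordMap (powMorphism φ q))^[N] [a]).map ψ := by
  have hpre : ∀ N, ((wordMap (powMorphism φ q))^[N] [a]).map ψ =
      factorAt (fun i => ψ (α i)) 0 ((wordMap φ)^[q * N] [a]).length := fun N => by
    rw [iterate_powMorphism, ← map_factorAt, hfix]
  simp only [hpre]
  constructor
  · rintro ⟨i, hi⟩
    obtain ⟨N, hN⟩ := eventually_atTop.1 (hpro.2.eventually_ge_atTop (i + w.length))
    refine ⟨N, ?_⟩
    rw [hi]
    exact factorAt_infix (by simpa [length_factorAt] using hN _ (Nat.le_mul_of_pos_left N hq))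
  · rintro ⟨N, hN⟩
    exact isFactor_of_infix hN

end Factors

section Assembly

variable {A B : Type*} {φ : A → List A} {ψ : A → B} {P k : ℕ} {I : Set (List A)}
  {L : Set (List B)} {a : A}

/-- If broken runs of degree at most `k` do not occur, the number of factors of length `n` is
`O(n ^ (1 + 1 / (k + 1)))`. -/
theorem MorphicSystem.isBigO_rpow [Finite A] [Finite B] (h : MorphicSystem φ ψ P I L)
    (hT : NoBrokenRun P k L) (ha : [a] ∈ I) :
    (fun n => ({w | w.length = n ∧ ∃ N, w <:+: ((wordMap φ)^[N] [a]).map ψ}.ncard : ℝ))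
      =O[atTop] fun n : ℕ => (n : ℝ) ^ ((1 : ℝ) + 1 / (k + 1 : ℕ)) := by
  have := Fintype.ofFinite B
  obtain ⟨M, hM, hlen⟩ := exists_pow_le_length φ k
  set κ : ℕ → ℕ := fun m => 2 * ⌈((M * m : ℕ) : ℝ) ^ ((1 : ℝ) / (k + 1 : ℕ))⌉₊ with hκdef
  have hκmono : Monotone κ := fun m m' hm => by
    simp only [hκdef]
    gcongr
  have hρ : ∀ b ∉ level φ k, ∀ N, (∑ i ∈ Finset.range N, i ^ k) / M ≤
      ∑ i ∈ Finset.range N, ((wordMap φ)^[i] [b]).length := by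
    intro b hb N
    refine Nat.div_le_of_le_mul ?_
    rw [Finset.mul_sum]
    exact Finset.sum_le_sum fun i _ => hlen b hb i
  have hκ : ∀ m N, κ m ≤ N → m ≤ (∑ i ∈ Finset.range N, i ^ k) / M := by
    intro m N hN
    set a := ⌈((M * m : ℕ) : ℝ) ^ ((1 : ℝ) / (k + 1 : ℕ))⌉₊ with ha
    have hN : 2 * a ≤ N := hN
    have h1 : M * m ≤ a ^ (k + 1) := by
      have h2 := Nat.le_ceil (((M * m : ℕ) : ℝ) ^ ((1 : ℝ) / (k + 1 : ℕ)))
      have h3 : ((M * m : ℕ) : ℝ) ≤ (a : ℝ) ^ (k + 1) := by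
        calc ((M * m : ℕ) : ℝ) = (((M * m : ℕ) : ℝ) ^ ((1 : ℝ) / (k + 1 : ℕ))) ^ (k + 1) := by
              rw [one_div, Real.rpow_inv_natCast_pow (by positivity) (by omega)]
          _ ≤ _ := by gcongr
      exact_mod_cast h3
    rw [Nat.le_div_iff_mul_le hM, mul_comm]
    calc M * m ≤ a ^ (k + 1) := h1
      _ = ∑ i ∈ Finset.Ico a (2 * a), a ^ k := by
        rw [Finset.sum_const, Nat.card_Ico, two_mul, Nat.add_sub_cancel, smul_eq_mul, pow_succ']
      _ ≤ ∑ i ∈ Finset.Ico a (2 * a), i ^ k :=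
        Finset.sum_le_sum fun i hi => Nat.pow_le_pow_left (Finset.mem_Ico.1 hi).1 k
      _ ≤ ∑ i ∈ Finset.range N, i ^ k :=
        Finset.sum_le_sum_of_subset fun i hi =>
          Finset.mem_range.2 ((Finset.mem_Ico.1 hi).2.trans_le hN)
  obtain ⟨C, c₀, hC⟩ := h.exists_factor_bound hρ hκ hκmono hT ha
  refine IsBigO.of_bound (C * 2 * (4 * M + 3) : ℕ) (eventually_atTop.2 ⟨c₀ + 2, fun n hn => ?_⟩)
  have hn1 : (1 : ℝ) ≤ n := by exact_mod_cast (show 1 ≤ n by omega)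
  have hroot : 1 ≤ (n : ℝ) ^ ((1 : ℝ) / (k + 1 : ℕ)) := Real.one_le_rpow hn1 (by positivity)
  have hκle : (κ (n + c₀) : ℝ) + 1 ≤ (4 * M + 3) * (n : ℝ) ^ ((1 : ℝ) / (k + 1 : ℕ)) := by
    have h1 := (Nat.ceil_lt_add_one (a := ((M * (n + c₀) : ℕ) : ℝ) ^ ((1 : ℝ) / (k + 1 : ℕ)))
      (by positivity)).le
    have h2 : ((M * (n + c₀) : ℕ) : ℝ) ^ ((1 : ℝ) / (k + 1 : ℕ)) ≤
        2 * M * (n : ℝ) ^ ((1 : ℝ) / (k + 1 : ℕ)) := by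
      have h3 : ((M * (n + c₀) : ℕ) : ℝ) ≤ (2 * M : ℕ) * n := by
        have : M * (n + c₀) ≤ 2 * M * n := by nlinarith
        exact_mod_cast this
      have h4 : ((2 * M : ℕ) : ℝ) ^ ((1 : ℝ) / (k + 1 : ℕ)) ≤ (2 * M : ℕ) := by
        refine Real.rpow_le_self_of_one_le (by exact_mod_cast (by omega : 1 ≤ 2 * M)) ?_
        rw [div_le_one (by positivity)]
        exact_mod_cast (by omega : 1 ≤ k + 1)
      calc _ ≤ (((2 * M : ℕ) : ℝ) * n) ^ ((1 : ℝ) / (k + 1 : ℕ)) := by gcongr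
        _ = ((2 * M : ℕ) : ℝ) ^ ((1 : ℝ) / (k + 1 : ℕ)) * (n : ℝ) ^ ((1 : ℝ) / (k + 1 : ℕ)) :=
          Real.mul_rpow (by positivity) (by positivity)
        _ ≤ (2 * M : ℕ) * (n : ℝ) ^ ((1 : ℝ) / (k + 1 : ℕ)) := by gcongr
        _ = _ := by push_cast; ring
    simp only [hκdef]
    rw [Nat.cast_mul, Nat.cast_two]
    nlinarith
  rw [Real.norm_of_nonneg (by positivity), Real.norm_of_nonneg (by positivity),
    Real.rpow_add (by linarith), Real.rpow_one]
  calc _ ≤ ((C * ((n + 1) * (κ (n + c₀) + 1)) : ℕ) : ℝ) := by exact_mod_cast hC n (by omega)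
    _ = C * (((n : ℝ) + 1) * (κ (n + c₀) + 1)) := by push_cast; ring
    _ ≤ C * ((2 * n) * ((4 * M + 3) * (n : ℝ) ^ ((1 : ℝ) / (k + 1 : ℕ)))) := by
      gcongr
      linarith
    _ = _ := by push_cast; ring

/-- If broken runs do not occur at all, the number of factors of length `n` is `O(n log n)`. -/
theorem MorphicSystem.isBigO_mul_log [Finite A] [Finite B] (h : MorphicSystem φ ψ P I L)
    (hT : ∀ k, NoBrokenRun P k L) (ha : [a] ∈ I) :
    (fun n => ({w | w.length = n ∧ ∃ N, w <:+: ((wordMap φ)^[N] [a]).map ψ}.ncard : ℝ))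
      =O[atTop] fun n : ℕ => (n : ℝ) * Real.log n := by
  have := Fintype.ofFinite B
  obtain ⟨k, hk⟩ := exists_level_eq_succ φ
  obtain ⟨M, hM, hlen⟩ := exists_two_pow_le_length hk
  have hκ : ∀ m N, M * (Nat.log 2 m + 1) + 1 ≤ N → m ≤ ∑ i ∈ Finset.range N, 2 ^ (i / M) := by
    intro m N hN
    have h1 : Nat.log 2 m + 1 ≤ (N - 1) / M := by
      rw [Nat.le_div_iff_mul_le hM, mul_comm]
      omega
    calc m ≤ 2 ^ (Nat.log 2 m + 1) := (Nat.lt_pow_succ_log_self one_lt_two m).le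
      _ ≤ 2 ^ ((N - 1) / M) := Nat.pow_le_pow_right two_pos h1
      _ ≤ _ := Finset.single_le_sum (f := fun i => 2 ^ (i / M)) (fun _ _ => Nat.zero_le _)
        (Finset.mem_range.2 (by omega))
  have hκmono : Monotone fun m => M * (Nat.log 2 m + 1) + 1 := fun m m' hm => by
    have := Nat.log_mono_right (b := 2) hm
    dsimp only
    gcongr
  obtain ⟨C, c₀, hC⟩ := h.exists_factor_bound
    (fun b hb N => Finset.sum_le_sum fun i _ => hlen b hb i) hκ hκmono (hT k) ha
  refine IsBigO.of_bound (C * 2 * (6 * M + 4) : ℕ) (eventually_atTop.2 ⟨c₀ + 2, fun n hn => ?_⟩)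
  have hn2 : (2 : ℝ) ≤ n := by exact_mod_cast (show 2 ≤ n by omega)
  have hlog2 : (1 : ℝ) / 2 < Real.log 2 := by linarith [Real.log_two_gt_d9]
  have hlogn : (1 : ℝ) / 2 ≤ Real.log n :=
    hlog2.le.trans (Real.log_le_log (by norm_num) hn2)
  have hnat : (Nat.log 2 (n + c₀) : ℝ) ≤ 4 * Real.log n := by
    have h1 : n + c₀ ≤ n ^ 2 := by nlinarith
    have h2 : 2 ^ Nat.log 2 (n + c₀) ≤ n ^ 2 := (Nat.pow_log_le_self 2 (by omega)).trans h1
    have h3 : (2 : ℝ) ^ Nat.log 2 (n + c₀) ≤ (n : ℝ) ^ 2 := by exact_mod_cast h2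
    have h4 := Real.log_le_log (by positivity) h3
    rw [Real.log_pow, Real.log_pow] at h4
    have h5 : (0 : ℝ) ≤ Nat.log 2 (n + c₀) := by positivity
    push_cast at h4
    nlinarith
  rw [Real.norm_of_nonneg (by positivity), Real.norm_of_nonneg (by positivity)]
  calc _ ≤ ((C * ((n + 1) * (M * (Nat.log 2 (n + c₀) + 1) + 1 + 1)) : ℕ) : ℝ) := by
        exact_mod_cast hC n (by omega)
    _ = C * (((n : ℝ) + 1) * (M * (Nat.log 2 (n + c₀) + 1) + 2)) := by push_cast; ring
    _ ≤ C * ((2 * n) * (M * (4 * Real.log n + 2 * Real.log n) + 4 * Real.log n)) := by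
      gcongr <;> linarith
    _ = _ := by push_cast; ring

theorem exists_pos_dvd_of_eventually_length [Finite A] (φ : A → List A) :
    ∃ P, 0 < P ∧ ∀ c u m, u <:+: φ c → 0 < m →
      (∀ᶠ N in atTop, ((wordMap φ)^[N] u).length = m) → m ∣ P := by
  classical
  have hfin : {u | ∃ c, u <:+: φ c}.Finite := by
    rw [Set.ofPred_exists]
    exact Set.finite_iUnion fun c => (List.finite_toSet (φ c).sublists).subset
      fun u hu => List.mem_sublists.2 hu.sublist
  have hex : ∀ u, ∃ m', 0 < m' ∧ ∀ m, 0 < m →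
      (∀ᶠ N in atTop, ((wordMap φ)^[N] u).length = m) → m = m' := by
    intro u
    by_cases h : ∃ m, 0 < m ∧ ∀ᶠ N in atTop, ((wordMap φ)^[N] u).length = m
    · obtain ⟨m', h0, h1⟩ := h
      refine ⟨m', h0, fun m _ h2 => ?_⟩
      obtain ⟨N, h3, h4⟩ := (h1.and h2).exists
      omega
    · exact ⟨1, one_pos, fun m h0 h1 => (h ⟨m, h0, h1⟩).elim⟩
  choose g hg using hex
  refine ⟨∏ u ∈ hfin.toFinset, g u, Finset.prod_pos fun u _ => (hg u).1, ?_⟩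
  intro c u m hu hm h
  rw [(hg u).2 m hm h]
  exact Finset.dvd_prod_of_mem g (hfin.mem_toFinset.2 ⟨c, hu⟩)

/-- The factors of the iterates of a letter form a system. -/
theorem exists_morphicSystem [Finite A] (φ : A → List A) (ψ : A → B) (a : A) :
    ∃ q P, 0 < q ∧ MorphicSystem (powMorphism φ q) ψ P
      {y | ∃ N, y <:+: (wordMap (powMorphism φ q))^[N] [a]}
      {w | ∃ N, w <:+: ((wordMap (powMorphism φ q))^[N] [a]).map ψ} := by
  obtain ⟨q, hq, hidem⟩ := exists_forall_iterate_idempotent A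
  obtain ⟨P, hP, hdvd⟩ := exists_pos_dvd_of_eventually_length (powMorphism φ q)
  refine ⟨q, P, hq, ⟨hP, ?_, ?_, ?_, ?_, exists_firstIdempotent_pow φ hq hidem, ?_, hdvd⟩⟩
  · rintro w ⟨N, hN⟩ w' hw'
    exact ⟨N, hw'.trans hN⟩
  · rintro w ⟨N, hN⟩ w' hw'
    exact ⟨N, hw'.trans hN⟩
  · rintro y ⟨N, hN⟩
    refine ⟨N + 1, ?_⟩
    rw [Function.iterate_succ_apply']
    exact iterate_infix _ hN 1
  · rintro y ⟨N, hN⟩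
    exact ⟨N, hN.map ψ⟩
  · rw [← powMorphism_revMorphism]
    exact exists_firstIdempotent_pow _ hq hidem

end Assembly

/-- Devyatov: the complexity of a morphic sequence is Θ(n^(1+1/k)) for some k ≥ 1,
or O(n log n). -/
theorem devyatov {A Δ : Type*} [Fintype A] [Fintype Δ] (φ : A → List A) (a : A)
    (α : ℕ → A) (ψ : A → Δ) (hpro : Prolongable φ a) (hfix : IsFixedSeq φ a α) :
    (∃ k : ℕ, 1 ≤ k ∧
      (fun n => (complexity (fun i => ψ (α i)) n : ℝ)) =Θ[atTop]
        (fun n => (n : ℝ) ^ ((1 : ℝ) + 1 / k))) ∨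
    (fun n => (complexity (fun i => ψ (α i)) n : ℝ)) =O[atTop]
      (fun n => (n : ℝ) * Real.log n) := by
  classical
  obtain ⟨q, P, hq, hsys⟩ := exists_morphicSystem φ ψ a
  have ha : [a] ∈ {y | ∃ N, y <:+: (wordMap (powMorphism φ q))^[N] [a]} :=
    ⟨0, List.infix_refl _⟩
  have hiff := isFactor_iff_exists_infix (ψ := ψ) hpro hfix hq
  have hcomp : (fun n => (complexity (fun i => ψ (α i)) n : ℝ)) = fun n =>
      ({w | w.length = n ∧
        ∃ N, w <:+: ((wordMap (powMorphism φ q))^[N] [a]).map ψ}.ncard : ℝ) := by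
    simp only [complexity, hiff]
  by_cases hT : ∀ k, NoBrokenRun P k
      {w | ∃ N, w <:+: ((wordMap (powMorphism φ q))^[N] [a]).map ψ}
  · right
    rw [hcomp]
    exact hsys.isBigO_mul_log hT ha
  · left
    rw [not_forall] at hT
    have hspec := Nat.find_spec hT
    have hmin := fun y => Nat.find_min hT (m := y)
    cases hk : Nat.find hT with
    | zero =>
      rw [hk] at hspec
      exact absurd NoBrokenRun.zero hspec
    | succ k =>
      rw [hk] at hspec hmin
      refine ⟨k + 1, by omega, ?_, ?_⟩
      · rw [hcomp]
        exact hsys.isBigO_rpow (not_not.1 (hmin k (by omega))) ha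
      · exact isBigO_complexity_of_not_noBrokenRun (fun w hw => (hiff w).2 hw) hspec
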